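/- arXiv:2512.21315 — 3 statements merged into one kernel-verified Lean document; each statement's English description precedes it below -/
import Mathlib

section
/- Fix σ > 0, M > 0 and positive integers N₁, N₂ with N₂ ≤ N₁; set N = N₁ and γ = N₂/N₁. There exists a constant C ≥ 0 (depending only on σ, M, N₁, N₂) such that for every dimension d ≥ 1 and every vector μ ∈ ℝ^d whose entries satisfy |μᵢ| ≤ M for all i, the following holds. Let x_{1,1},…,x_{N₁,1} be i.i.d. with the product Gaussian law on ℝ^d whose coordinates are independent N(−μᵢ, σ²), let x_{1,2},…,x_{N₂,2} be i.i.d. with coordinates independent N(μᵢ, σ²), all training samples independent; let y be uniform on {1,2} independent of the training samples, and let the test point x have conditional law given y = j equal to the product Gaussian with mean μ_j and covariance σ²I_d, where μ₁ = −μ and μ₂ = μ. Let μ̂_j = (1/N_j)·Σ_{i=1}^{N_j} x_{i,j}, and let the classifier output ĉ = 1 if ‖x − μ̂₁‖ ≤ ‖x − μ̂₂‖ and ĉ = 2 otherwise (Euclidean norms). Then |P(ĉ ≠ y) − p̂(S, N, γ, d)| ≤ C/√d, where S = ‖μ‖²/σ². -/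
open MeasureTheory

/-- The Gaussian tail function `Q(x) = (1/√(2π)) · ∫_x^∞ exp(−t²/2) dt`. -/
noncomputable def gaussQ (x : ℝ) : ℝ :=
  (Real.sqrt (2 * Real.pi))⁻¹ * ∫ t in Set.Ioi x, Real.exp (-t ^ 2 / 2)

/-- The approximate probability of error `p̂(S, N, γ, q)` from the paper. -/
noncomputable def phat (S N γ q : ℝ) : ℝ :=
  (1 / 2) * gaussQ ((Real.sqrt S + (1 / (4 * N)) * ((1 - γ) / γ) * (q / Real.sqrt S)) /
      Real.sqrt ((1 / (4 * N)) * ((1 + γ) / γ) * (q / S)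
        + (1 / (8 * N ^ 2)) * ((1 + γ ^ 2) / γ ^ 2) * (q / S) + 1 / (γ * N) + 1))
  + (1 / 2) * gaussQ ((Real.sqrt S - (1 / (4 * N)) * ((1 - γ) / γ) * (q / Real.sqrt S)) /
      Real.sqrt ((1 / (4 * N)) * ((1 + γ) / γ) * (q / S)
        + (1 / (8 * N ^ 2)) * ((1 + γ ^ 2) / γ ^ 2) * (q / S) + 1 / N + 1))

open ProbabilityTheory

/-- Product Gaussian measure on `ℝ^d` with mean vector `m` and covariance `σ²·I_d`. -/
noncomputable def gaussVec {d : ℕ} (σ : ℝ) (m : Fin d → ℝ) : Measure (Fin d → ℝ) :=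
  Measure.pi fun i => gaussianReal (m i) ((σ ^ 2).toNNReal)

/-- The Euclidean distance on `ℝ^d`. -/
noncomputable def eDist {d : ℕ} (a b : Fin d → ℝ) : ℝ :=
  Real.sqrt (∑ i, (a i - b i) ^ 2)

/-- The empirical mean of `n` sample vectors. -/
noncomputable def empMean {d n : ℕ} (t : Fin n → Fin d → ℝ) : Fin d → ℝ :=
  fun i => (∑ j, t j i) / n

/-- The probability of error of the plug-in nearest-empirical-mean classifier, computed
over the joint randomness of the training samples (`N₁` i.i.d. samples from
`N(−μ, σ²I_d)` and `N₂` i.i.d. samples from `N(μ, σ²I_d)`), the uniform label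
`y ∈ {1,2}` and the test point `x ~ N(μ_y, σ²I_d)` with `μ₁ = −μ, μ₂ = μ`:
the classifier outputs `ĉ = 1` iff `‖x − μ̂₁‖ ≤ ‖x − μ̂₂‖`. -/
noncomputable def errProb (σ : ℝ) (N₁ N₂ : ℕ) {d : ℕ} (μ : Fin d → ℝ) : ℝ :=
  (1 / 2) *
      ((((Measure.pi fun _ : Fin N₁ => gaussVec σ (-μ)).prod
            (Measure.pi fun _ : Fin N₂ => gaussVec σ μ)).prod (gaussVec σ (-μ)))
        {p : ((Fin N₁ → Fin d → ℝ) × (Fin N₂ → Fin d → ℝ)) × (Fin d → ℝ) |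
          ¬ eDist p.2 (empMean p.1.1) ≤ eDist p.2 (empMean p.1.2)}).toReal
  + (1 / 2) *
      ((((Measure.pi fun _ : Fin N₁ => gaussVec σ (-μ)).prod
            (Measure.pi fun _ : Fin N₂ => gaussVec σ μ)).prod (gaussVec σ μ))
        {p : ((Fin N₁ → Fin d → ℝ) × (Fin N₂ → Fin d → ℝ)) × (Fin d → ℝ) |
          eDist p.2 (empMean p.1.1) ≤ eDist p.2 (empMean p.1.2)}).toReal

open Set Filter Topology

lemma abs_sub_le_of_hasDerivAt_bound {f f' : ℝ → ℝ} {r C : ℝ}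
    (hf : ∀ t, HasDerivAt f (f' t) t) (hb : ∀ t, |t| ≤ r → |f' t| ≤ C) {t : ℝ} (ht : |t| ≤ r) :
    |f t - f 0| ≤ C * |t| := by
  have h := (convex_closedBall (0 : ℝ) r).norm_image_sub_le_of_norm_hasDerivWithin_le
    (f := f) (f' := f') (C := C) (x := 0) (y := t)
    (fun x _ => (hf x).hasDerivWithinAt) (fun x hx => hb x (by simpa using hx))
    (by simpa using (abs_nonneg t).trans ht) (by simpa using ht)
  simpa using h

lemma taylor_two_bound {f f' f'' : ℝ → ℝ} {K : ℝ} (hf : ∀ t, HasDerivAt f (f' t) t)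
    (hf' : ∀ t, HasDerivAt f' (f'' t) t) (hK : ∀ t, |f'' t| ≤ K) (x h : ℝ) :
    |f (x + h) - f x - f' x * h| ≤ K * h ^ 2 := by
  have h1 : ∀ t, |t| ≤ |h| → |f' (x + t) - f' x| ≤ K * |h| := fun t ht => by
    have := abs_sub_le_of_hasDerivAt_bound (f := fun t => f' (x + t)) (r := |h|)
      (fun t => (hf' (x + t)).comp_const_add x t) (fun t _ => hK (x + t)) ht
    simp only [add_zero] at this
    exact this.trans (by gcongr; exact (abs_nonneg _).trans (hK 0))
  have h2 := abs_sub_le_of_hasDerivAt_bound (f := fun t => f (x + t) - f' x * t) (r := |h|)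
    (f' := fun t => f' (x + t) - f' x)
    (fun t => by
      simpa using ((hf (x + t)).comp_const_add x t).fun_sub ((hasDerivAt_id t).const_mul (f' x)))
    h1 le_rfl
  simp only [add_zero, mul_zero, sub_zero] at h2
  calc |f (x + h) - f x - f' x * h| = |f (x + h) - f' x * h - f x| := by ring_nf
    _ ≤ K * |h| * |h| := h2
    _ = K * h ^ 2 := by rw [mul_assoc, abs_mul_abs_self]; ring

lemma taylor_three_bound {f f' f'' f''' : ℝ → ℝ} {K : ℝ} (hf : ∀ t, HasDerivAt f (f' t) t)
    (hf' : ∀ t, HasDerivAt f' (f'' t) t) (hf'' : ∀ t, HasDerivAt f'' (f''' t) t)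
    (hK : ∀ t, |f''' t| ≤ K) (x h : ℝ) :
    |f (x + h) - f x - f' x * h - f'' x / 2 * h ^ 2| ≤ K * |h| ^ 3 := by
  have hK0 : 0 ≤ K := (abs_nonneg _).trans (hK 0)
  have h1 : ∀ t, |t| ≤ |h| → |f' (x + t) - f' x - f'' x * t| ≤ K * |h| ^ 2 := fun t ht => by
    refine (taylor_two_bound hf' hf'' hK x t).trans ?_
    rw [← sq_abs t]
    gcongr
  have h2 := abs_sub_le_of_hasDerivAt_bound
    (f := fun t => f (x + t) - f' x * t - f'' x / 2 * t ^ 2) (r := |h|)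
    (f' := fun t => f' (x + t) - f' x - f'' x * t)
    (fun t => by
      have := (((hf (x + t)).comp_const_add x t).fun_sub
        ((hasDerivAt_id t).const_mul (f' x))).fun_sub ((hasDerivAt_pow 2 t).const_mul (f'' x / 2))
      exact this.congr_deriv (by simp; ring))
    h1 le_rfl
  simp only [add_zero, mul_zero, sub_zero, ne_eq, OfNat.ofNat_ne_zero, not_false_eq_true,
    zero_pow] at h2
  calc _ = |f (x + h) - f' x * h - f'' x / 2 * h ^ 2 - f x| := by ring_nf
    _ ≤ K * |h| ^ 2 * |h| := h2
    _ = K * |h| ^ 3 := by ring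

/-- The standard Gaussian density. -/
noncomputable def gaussDensity (x : ℝ) : ℝ :=
  (Real.sqrt (2 * Real.pi))⁻¹ * Real.exp (-x ^ 2 / 2)

lemma integrable_exp_neg_sq_div_two : Integrable fun t : ℝ => Real.exp (-t ^ 2 / 2) := by
  convert integrable_exp_neg_mul_sq (b := 1 / 2) (by norm_num) using 2 with t
  ring_nf

lemma hasDerivAt_gaussQ (x : ℝ) : HasDerivAt gaussQ (-gaussDensity x) x := by
  have hi := integrable_exp_neg_sq_div_two
  have hc : Continuous fun t : ℝ => Real.exp (-t ^ 2 / 2) := by fun_prop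
  have h : gaussQ = fun x => (Real.sqrt (2 * Real.pi))⁻¹ *
      ((∫ t in Ioi (0 : ℝ), Real.exp (-t ^ 2 / 2)) - ∫ t in (0 : ℝ)..x, Real.exp (-t ^ 2 / 2)) := by
    ext x
    rw [gaussQ, ← intervalIntegral.integral_interval_add_Ioi (a := 0) (b := x) hi.integrableOn
      hi.integrableOn]
    ring
  rw [h]
  have := ((hc.integral_hasStrictDerivAt 0 x).hasDerivAt.const_sub
    (∫ t in Ioi (0 : ℝ), Real.exp (-t ^ 2 / 2))).const_mul (Real.sqrt (2 * Real.pi))⁻¹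
  exact this.congr_deriv (by simp only [gaussDensity]; ring)

lemma hasDerivAt_gaussDensity (x : ℝ) : HasDerivAt gaussDensity (-(x * gaussDensity x)) x := by
  have h : HasDerivAt (fun x : ℝ => -x ^ 2 / 2) (-x) x := by
    exact ((hasDerivAt_pow 2 x).fun_neg.div_const 2).congr_deriv (by simp; ring)
  exact (h.exp.const_mul (Real.sqrt (2 * Real.pi))⁻¹).congr_deriv
    (by simp only [gaussDensity]; ring)

lemma continuous_gaussQ : Continuous gaussQ :=
  continuous_iff_continuousAt.2 fun x => (hasDerivAt_gaussQ x).continuousAt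

lemma gaussDensity_mul_bound (x : ℝ) : (1 + x ^ 2 / 2) * gaussDensity x ≤ 1 := by
  have h1 : (Real.sqrt (2 * Real.pi))⁻¹ ≤ 1 := by
    apply inv_le_one_of_one_le₀
    rw [Real.one_le_sqrt]
    linarith [Real.pi_gt_three]
  have h2 : (1 + x ^ 2 / 2) * Real.exp (-x ^ 2 / 2) ≤ 1 := by
    calc _ ≤ Real.exp (x ^ 2 / 2) * Real.exp (-x ^ 2 / 2) := by
          gcongr
          linarith [Real.add_one_le_exp (x ^ 2 / 2)]
      _ = 1 := by rw [← Real.exp_add]; simp [neg_div]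
  rw [gaussDensity]
  calc _ = (Real.sqrt (2 * Real.pi))⁻¹ * ((1 + x ^ 2 / 2) * Real.exp (-x ^ 2 / 2)) := by ring
    _ ≤ 1 * 1 := by gcongr
    _ = 1 := one_mul 1

lemma gaussDensity_nonneg (x : ℝ) : 0 ≤ gaussDensity x := by unfold gaussDensity; positivity

lemma gaussQ_taylor_two (x h : ℝ) :
    |gaussQ (x + h) - gaussQ x - -gaussDensity x * h| ≤ 2 * h ^ 2 := by
  refine taylor_two_bound hasDerivAt_gaussQ (f'' := fun t => t * gaussDensity t)
    (fun t => by simpa using (hasDerivAt_gaussDensity t).fun_neg) (fun t => ?_) x h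
  have h1 := gaussDensity_mul_bound t
  have h2 := gaussDensity_nonneg t
  rw [abs_le]
  constructor <;> nlinarith [mul_nonneg (sq_nonneg (t - 1)) h2, mul_nonneg (sq_nonneg (t + 1)) h2]

lemma gaussQ_taylor_three (x h : ℝ) :
    |gaussQ (x + h) - gaussQ x - -gaussDensity x * h - x * gaussDensity x / 2 * h ^ 2|
      ≤ 2 * |h| ^ 3 := by
  refine taylor_three_bound hasDerivAt_gaussQ (f'' := fun t => t * gaussDensity t)
    (f''' := fun t => gaussDensity t - t ^ 2 * gaussDensity t)
    (fun t => by simpa using (hasDerivAt_gaussDensity t).fun_neg) (fun t => ?_) (fun t => ?_) x h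
  · exact ((hasDerivAt_id t).fun_mul (hasDerivAt_gaussDensity t)).congr_deriv (by simp; ring)
  · have h1 := gaussDensity_mul_bound t
    have h2 := gaussDensity_nonneg t
    rw [abs_le]
    constructor <;> nlinarith [mul_nonneg (sq_nonneg t) h2]

lemma gaussianReal_real_Ioi (t : ℝ) : (gaussianReal 0 1).real (Ioi t) = gaussQ t := by
  rw [measureReal_def, gaussianReal_apply_eq_integral _ one_ne_zero, ENNReal.toReal_ofReal
    (integral_nonneg fun x => gaussianPDFReal_nonneg _ _ _), gaussQ, ← integral_const_mul]
  simp [gaussianPDFReal]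

lemma gaussQ_neg (x : ℝ) : gaussQ (-x) = 1 - gaussQ x := by
  have h : (gaussianReal 0 1).real (Ioi (-x)) = (gaussianReal 0 1).real (Iio x) := by
    conv_lhs => rw [← neg_zero, ← gaussianReal_map_neg]
    rw [map_measureReal_apply measurable_neg measurableSet_Ioi]
    congr 1
    ext y; simp
  have := nullSingletonClass_gaussianReal (μ := 0) (v := 1) one_ne_zero
  rw [← gaussianReal_real_Ioi, h, ← gaussianReal_real_Ioi, ← measureReal_congr Iio_ae_eq_Iic.symm,
    ← probReal_compl_eq_one_sub measurableSet_Ioi, compl_Ioi]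

lemma gaussQ_zero : gaussQ 0 = 1 / 2 := by
  have := gaussQ_neg 0
  rw [neg_zero] at this
  linarith

/-- The probability that a Gaussian variable of mean `z` and variance `V` is negative. -/
noncomputable def lowTail (z V : ℝ) : ℝ := (gaussianReal z V.toNNReal).real (Iio 0)

lemma lowTail_nonneg (z V : ℝ) : 0 ≤ lowTail z V := measureReal_nonneg

lemma lowTail_le_one (z V : ℝ) : lowTail z V ≤ 1 := measureReal_le_one

lemma map_stdGaussian (z : ℝ) (V : ℝ) (hV : 0 ≤ V) :
    (gaussianReal 0 1).map (fun x => z + Real.sqrt V * x) = gaussianReal z V.toNNReal := by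
  have h : (fun x => z + Real.sqrt V * x) = (z + ·) ∘ (Real.sqrt V * ·) := rfl
  rw [h, ← Measure.map_map (by fun_prop) (by fun_prop), gaussianReal_map_const_mul,
    gaussianReal_map_const_add]
  congr 1
  · simp
  · ext; simp [Real.sq_sqrt hV, Real.coe_toNNReal _ hV]

lemma lowTail_eq (z : ℝ) {V : ℝ} (hV : 0 < V) : lowTail z V = gaussQ (z / Real.sqrt V) := by
  have hs := Real.sqrt_pos.2 hV
  rw [← gaussianReal_real_Ioi, lowTail, ← map_stdGaussian z V hV.le,
    map_measureReal_apply (by fun_prop) measurableSet_Iio]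
  conv_lhs => rw [← neg_zero, ← gaussianReal_map_neg]
  rw [map_measureReal_apply measurable_neg (measurableSet_Iio.preimage (by fun_prop))]
  congr 1
  ext x
  simp only [mem_preimage, mem_Iio, mem_Ioi, div_lt_iff₀ hs]
  constructor <;> intro h <;> linarith

lemma continuous_lowTail {V : ℝ} (hV : 0 < V) : Continuous fun z => lowTail z V := by
  simp_rw [lowTail_eq _ hV]
  exact continuous_gaussQ.comp (by fun_prop)

lemma lowTail_taylor_two (z : ℝ) {V : ℝ} (hV : 0 < V) :
    ∃ p : ℝ, ∀ h, |lowTail (z + h) V - lowTail z V - p * h| ≤ 2 / V * h ^ 2 := by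
  refine ⟨-gaussDensity (z / √V) / √V, fun h => ?_⟩
  simp only [lowTail_eq _ hV, add_div]
  have := gaussQ_taylor_two (z / √V) (h / √V)
  rw [div_pow, Real.sq_sqrt hV.le] at this
  convert! this using 1 <;> ring_nf

lemma lowTail_taylor_three (z : ℝ) {V : ℝ} (hV : 0 < V) :
    ∃ p q : ℝ, ∀ h, |lowTail (z + h) V - lowTail z V - p * h - q * h ^ 2|
      ≤ 2 / √V ^ 3 * |h| ^ 3 := by
  refine ⟨-gaussDensity (z / √V) / √V,
    z / √V * gaussDensity (z / √V) / 2 / √V ^ 2, fun h => ?_⟩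
  simp only [lowTail_eq _ hV, add_div]
  have := gaussQ_taylor_three (z / √V) (h / √V)
  rw [abs_div, abs_of_nonneg (Real.sqrt_nonneg V), div_pow] at this
  convert! this using 1 <;> ring_nf

lemma integrable_lowTail {Ω : Type*} [MeasurableSpace Ω] {ν : Measure Ω} [IsProbabilityMeasure ν]
    {X : Ω → ℝ} (hX : AEMeasurable X ν) {V : ℝ} (hV : 0 < V) :
    Integrable (fun ω => lowTail (X ω) V) ν := by
  refine Integrable.of_bound
    ((continuous_lowTail hV).measurable.comp_aemeasurable hX).aestronglyMeasurable 1 ?_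
  filter_upwards with ω
  rw [Real.norm_eq_abs, abs_of_nonneg (lowTail_nonneg _ _)]
  exact lowTail_le_one _ _

lemma integral_lowTail_add_gaussian (z : ℝ) {V s : ℝ} (hV : 0 < V) (hs : 0 ≤ s) :
    ∫ g, lowTail (z + √s * g) V ∂gaussianReal 0 1 = lowTail z (V + s) := by
  have h1 : lowTail z (V + s) =
      ((gaussianReal 0 s.toNNReal) ∗ (gaussianReal z V.toNNReal)).real (Iio 0) := by
    rw [gaussianReal_conv_gaussianReal, lowTail, Real.toNNReal_add hV.le hs, zero_add, add_comm]
  rw [h1, measureReal_def, Measure.conv, Measure.map_apply (by fun_prop) measurableSet_Iio,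
    Measure.prod_apply (measurableSet_Iio.preimage (by fun_prop)), ← map_stdGaussian 0 s hs,
    lintegral_map (measurable_measure_prodMk_left (measurableSet_Iio.preimage (by fun_prop)))
      (by fun_prop), ← integral_toReal]
  · refine integral_congr_ae (.of_forall fun g => ?_)
    simp only [zero_add]
    rw [lowTail, ← gaussianReal_map_const_add,
      map_measureReal_apply (by fun_prop) measurableSet_Iio, measureReal_def]
    rfl
  · exact ((measurable_measure_prodMk_left (measurableSet_Iio.preimage (by fun_prop))).comp
      (by fun_prop)).aemeasurable
  · exact .of_forall fun g => measure_lt_top _ _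

/-- The third absolute moment of the standard Gaussian law. -/
noncomputable def gaussAbsThird : ℝ := ∫ g, |g| ^ 3 ∂gaussianReal 0 1

lemma integral_lowTail_taylor {Ω : Type*} [MeasurableSpace Ω] {ν : Measure Ω}
    [IsProbabilityMeasure ν] {V : ℝ} (hV : 0 < V) {z q p : ℝ}
    (hpq : ∀ h, |lowTail (z + h) V - lowTail z V - p * h - q * h ^ 2| ≤ 2 / √V ^ 3 * |h| ^ 3)
    {Y : Ω → ℝ} (hY : MemLp Y 3 ν) (hm : ∫ ω, Y ω ∂ν = 0) :
    |∫ ω, lowTail (z + Y ω) V ∂ν - (lowTail z V + q * ∫ ω, Y ω ^ 2 ∂ν)|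
      ≤ 2 / √V ^ 3 * ∫ ω, |Y ω| ^ 3 ∂ν := by
  have i1 : Integrable Y ν := hY.integrable (by norm_num)
  have i2 : Integrable (fun ω => Y ω ^ 2) ν :=
    (hY.mono_exponent (p := 2) (by norm_num)).integrable_sq
  have i3 : Integrable (fun ω => |Y ω| ^ 3) ν := hY.integrable_norm_pow (by norm_num)
  have i0 : Integrable (fun ω => lowTail (z + Y ω) V) ν :=
    integrable_lowTail (hY.aestronglyMeasurable.aemeasurable.const_add z) hV
  have j1 : Integrable (fun ω => lowTail (z + Y ω) V - lowTail z V) ν :=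
    i0.sub (integrable_const _)
  have j2 : Integrable (fun ω => lowTail (z + Y ω) V - lowTail z V - p * Y ω) ν :=
    j1.sub (i1.const_mul p)
  have e : ∫ ω, lowTail (z + Y ω) V ∂ν - (lowTail z V + q * ∫ ω, Y ω ^ 2 ∂ν)
      = ∫ ω, (lowTail (z + Y ω) V - lowTail z V - p * Y ω - q * Y ω ^ 2) ∂ν := by
    rw [integral_sub j2 (i2.const_mul q), integral_sub j1 (i1.const_mul p),
      integral_sub i0 (integrable_const _), integral_const_mul, integral_const_mul, hm]
    simp; ring
  rw [e, ← integral_const_mul]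
  refine abs_integral_le_integral_abs.trans (integral_mono ?_ (i3.const_mul _) fun ω => hpq _)
  exact (j2.sub (i2.const_mul q)).abs

lemma memLp_stdGaussian (p : NNReal) : MemLp (fun g : ℝ => g) p (gaussianReal 0 1) :=
  memLp_id_gaussianReal p

lemma integral_sq_stdGaussian : ∫ g, g ^ 2 ∂gaussianReal 0 1 = 1 := by
  have h := variance_eq_sub (X := fun g : ℝ => g) (memLp_stdGaussian 2)
  rw [variance_fun_id_gaussianReal] at h
  simpa [integral_id_gaussianReal] using h.symm

lemma integral_lowTail_one_step {Ω : Type*} [MeasurableSpace Ω] {ν : Measure Ω}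
    [IsProbabilityMeasure ν] {V : ℝ} (hV : 0 < V) (z : ℝ) {X : Ω → ℝ} {m s : ℝ}
    (hX : MemLp X 3 ν) (hm : ∫ ω, X ω ∂ν = m) (hs : ∫ ω, (X ω - m) ^ 2 ∂ν = s) :
    |∫ ω, lowTail (z + X ω) V ∂ν - lowTail (z + m) (V + s)|
      ≤ 2 / √V ^ 3 * (∫ ω, |X ω - m| ^ 3 ∂ν + √s ^ 3 * gaussAbsThird) := by
  have hs0 : 0 ≤ s := hs ▸ integral_nonneg fun ω => sq_nonneg _
  obtain ⟨p, q, hpq⟩ := lowTail_taylor_three (z + m) hV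
  have h1 := integral_lowTail_taylor hV hpq (hX.sub (memLp_const m)) (by
    rw [Pi.sub_def, integral_sub (hX.integrable (by norm_num)) (integrable_const m), hm]
    simp)
  have h2 := integral_lowTail_taylor hV hpq ((memLp_stdGaussian 3).const_mul (√s)) (by
    rw [integral_const_mul, integral_id_gaussianReal, mul_zero])
  simp only [Pi.sub_apply, hs] at h1
  simp only [mul_pow, abs_mul, integral_const_mul, Real.sq_sqrt hs0, integral_sq_stdGaussian,
    abs_of_nonneg (Real.sqrt_nonneg s),
    integral_lowTail_add_gaussian _ hV hs0, mul_one] at h2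
  have e : ∀ ω, z + m + (X ω - m) = z + X ω := fun ω => by ring
  simp only [e] at h1
  rw [gaussAbsThird]
  rw [abs_le] at *
  constructor <;> linarith

/-- Lindeberg's replacement argument for sums of functions of independent variables,
tested against the smooth functions `z ↦ lowTail z V`. -/
lemma lindeberg_lowTail {Ω : Type*} [MeasurableSpace Ω] (ν : Measure Ω)
    [IsProbabilityMeasure ν] {V₀ β : ℝ} (hV₀ : 0 < V₀) {n : ℕ} (X : Fin n → Ω → ℝ)
    (m s : Fin n → ℝ) (hmeas : ∀ i, Measurable (X i))
    (hX : ∀ i, MemLp (X i) 3 ν) (hm : ∀ i, ∫ ω, X i ω ∂ν = m i)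
    (hs : ∀ i, ∫ ω, (X i ω - m i) ^ 2 ∂ν = s i)
    (hβ : ∀ i, ∫ ω, |X i ω - m i| ^ 3 ∂ν + √(s i) ^ 3 * gaussAbsThird ≤ β)
    {V : ℝ} (hV : V₀ ≤ V) (z : ℝ) :
    |∫ ω, lowTail (z + ∑ i, X i (ω i)) V ∂(Measure.pi fun _ : Fin n => ν)
        - lowTail (z + ∑ i, m i) (V + ∑ i, s i)| ≤ n * (2 / √V₀ ^ 3 * β) := by
  induction n generalizing V z with
  | zero => simp
  | succ n ih =>
    have hVp : 0 < V := hV₀.trans_le hV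
    have hs0 : 0 ≤ s 0 := hs 0 ▸ integral_nonneg fun ω => sq_nonneg _
    have mp := (measurePreserving_piFinSuccAbove (fun _ : Fin (n + 1) => ν) 0).symm
    have e1 : ∫ ω, lowTail (z + ∑ i, X i (ω i)) V ∂(Measure.pi fun _ : Fin (n + 1) => ν)
        = ∫ ω, ∫ ω₀, lowTail ((z + ∑ i : Fin n, X i.succ (ω i)) + X 0 ω₀) V ∂ν
          ∂(Measure.pi fun _ : Fin n => ν) := by
      rw [← mp.integral_comp', ← integral_prod_swap, integral_prod]
      · simp [MeasurableEquiv.piFinSuccAbove, Fin.sum_univ_succ, add_assoc, add_comm (X 0 _)]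
      · refine integrable_lowTail (Measurable.aemeasurable ?_) hVp
        have := mp.measurable
        fun_prop
    have i1 : Integrable (fun ω : Fin n → Ω =>
        ∫ ω₀, lowTail ((z + ∑ i : Fin n, X i.succ (ω i)) + X 0 ω₀) V ∂ν)
        (Measure.pi fun _ : Fin n => ν) := by
      refine Integrable.integral_prod_left (f := fun p : (Fin n → Ω) × Ω =>
        lowTail ((z + ∑ i : Fin n, X i.succ (p.1 i)) + X 0 p.2) V) ?_
      refine integrable_lowTail (Measurable.aemeasurable ?_) hVp
      fun_prop
    have i2 : Integrable (fun ω : Fin n → Ω =>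
        lowTail (z + ∑ i : Fin n, X i.succ (ω i) + m 0) (V + s 0))
        (Measure.pi fun _ : Fin n => ν) := by
      refine integrable_lowTail (Measurable.aemeasurable ?_) (by linarith)
      fun_prop
    have step : |∫ ω, ∫ ω₀, lowTail ((z + ∑ i : Fin n, X i.succ (ω i)) + X 0 ω₀) V ∂ν
          ∂(Measure.pi fun _ : Fin n => ν) -
        ∫ ω, lowTail (z + ∑ i : Fin n, X i.succ (ω i) + m 0) (V + s 0)
          ∂(Measure.pi fun _ : Fin n => ν)| ≤ 2 / √V₀ ^ 3 * β := by
      rw [← integral_sub i1 i2, ← Real.norm_eq_abs]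
      refine (norm_integral_le_of_norm_le_const (C := 2 / √V₀ ^ 3 * β)
        (.of_forall fun ω => ?_)).trans (by simp)
      refine (integral_lowTail_one_step hVp _ (hX 0) (hm 0) (hs 0)).trans ?_
      have : 0 < √V₀ := Real.sqrt_pos.2 hV₀
      have h3 : 0 ≤ ∫ ω, |X 0 ω - m 0| ^ 3 ∂ν + √(s 0) ^ 3 * gaussAbsThird := by
        unfold gaussAbsThird; positivity
      gcongr
      exact hβ 0
    have hrec := ih (fun i => X i.succ) (fun i => m i.succ) (fun i => s i.succ)
      (fun i => hmeas _) (fun i => hX _) (fun i => hm _) (fun i => hs _) (fun i => hβ _)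
      (V := V + s 0) (by linarith) (z + m 0)
    simp only [Fin.sum_univ_succ]
    simp only [Fin.sum_univ_succ] at e1
    have c2 : z + (m 0 + ∑ i : Fin n, m i.succ) = z + ∑ i : Fin n, m i.succ + m 0 := by ring
    have c1 : ∀ a : ℝ, z + m 0 + a = z + a + m 0 := fun a => by ring
    simp only [c1] at hrec
    rw [e1, ← add_assoc V, c2]
    push_cast
    rw [add_mul, one_mul]
    rw [abs_le] at *
    constructor <;> linarith

lemma abs_lowTail_add_var_sub_le (z : ℝ) {V s : ℝ} (hV : 0 < V) (hs : 0 ≤ s) :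
    |lowTail z (V + s) - lowTail z V| ≤ 2 / V * s := by
  obtain ⟨p, hp⟩ := lowTail_taylor_two z hV
  have hg := memLp_stdGaussian 2
  have i1 : Integrable (fun g : ℝ => p * (√s * g)) (gaussianReal 0 1) :=
    ((hg.integrable (by norm_num)).const_mul _).const_mul _
  have i0 : Integrable (fun g : ℝ => lowTail (z + √s * g) V) (gaussianReal 0 1) :=
    integrable_lowTail (by fun_prop) hV
  have j1 : Integrable (fun g : ℝ => lowTail (z + √s * g) V - lowTail z V) (gaussianReal 0 1) :=
    i0.sub (integrable_const _)
  have e : lowTail z (V + s) - lowTail z V =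
      ∫ g, (lowTail (z + √s * g) V - lowTail z V - p * (√s * g)) ∂gaussianReal 0 1 := by
    rw [integral_sub j1 i1, integral_sub i0 (integrable_const _), integral_const_mul,
      integral_const_mul, integral_id_gaussianReal, integral_lowTail_add_gaussian z hV hs]
    simp
  calc |lowTail z (V + s) - lowTail z V|
      ≤ ∫ g, |lowTail (z + √s * g) V - lowTail z V - p * (√s * g)| ∂gaussianReal 0 1 :=
        e ▸ abs_integral_le_integral_abs
    _ ≤ ∫ g, 2 / V * s * g ^ 2 ∂gaussianReal 0 1 := by
        refine integral_mono (j1.sub i1).abs (hg.integrable_sq.const_mul _) fun g => ?_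
        refine (hp _).trans_eq ?_
        rw [mul_pow, Real.sq_sqrt hs, mul_assoc]
    _ = 2 / V * s := by rw [integral_const_mul, integral_sq_stdGaussian, mul_one]

lemma abs_lowTail_sub_le (z : ℝ) {V W : ℝ} (hW : 0 < W) :
    |lowTail z V - lowTail z W| ≤ 4 / W * |V - W| := by
  rcases le_or_gt W V with h | h
  · have := abs_lowTail_add_var_sub_le z hW (sub_nonneg.2 h)
    rw [add_sub_cancel] at this
    rw [abs_of_nonneg (sub_nonneg.2 h)]
    refine this.trans ?_
    have := sub_nonneg.2 h
    gcongr
    norm_num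
  rw [abs_of_neg (sub_neg.2 h), neg_sub, div_mul_eq_mul_div, le_div_iff₀ hW]
  rcases lt_or_ge V (W / 2) with h2 | h2
  · have : |lowTail z V - lowTail z W| ≤ 1 := abs_sub_le_of_nonneg_of_le (lowTail_nonneg _ _)
      (lowTail_le_one _ _) (lowTail_nonneg _ _) (lowTail_le_one _ _)
    nlinarith
  · have hV' : 0 < V := by linarith
    have := abs_lowTail_add_var_sub_le z hV' (sub_nonneg.2 h.le)
    rw [add_sub_cancel, abs_sub_comm, div_mul_eq_mul_div, le_div_iff₀ hV'] at this
    nlinarith [abs_nonneg (lowTail z V - lowTail z W)]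

lemma map_linear_pi_gaussianReal {ι : Type*} [Fintype ι] (m c : ι → ℝ) (v : NNReal) :
    (Measure.pi fun i => gaussianReal (m i) v).map (fun x => ∑ i, c i * x i) =
      gaussianReal (∑ i, c i * m i) ((∑ i, c i ^ 2) * v).toNNReal := by
  have hL : ∀ i, MemLp (fun x : ℝ => c i * x) 2 (gaussianReal (m i) v) := fun i =>
    (memLp_id_gaussianReal 2).const_mul (c i)
  have hG : HasGaussianLaw (fun x : ι → ℝ => ∑ i, c i * x i)
      (Measure.pi fun i => gaussianReal (m i) v) := by
    refine iIndepFun.hasGaussianLaw_fun_sum (fun i => ?_)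
      (iIndepFun_pi (X := fun i x => c i * x) fun i => by fun_prop)
    refine HasGaussianLaw.fun_smul (X := fun x : ι → ℝ => x i) (c i) ⟨?_⟩
    rw [(measurePreserving_eval (fun i => gaussianReal (m i) v) i).map_eq]
    infer_instance
  rw [hG.map_eq_gaussianReal]
  congr 1
  · rw [integral_finsetSum]
    · refine Finset.sum_congr rfl fun i _ => ?_
      rw [integral_comp_eval (μ := fun i => gaussianReal (m i) v) (f := fun x => c i * x) (by fun_prop),
        integral_const_mul, integral_id_gaussianReal]
    · intro i _
      exact ((hL i).comp_measurePreserving (measurePreserving_eval _ i)).integrable (by norm_num)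
  · have h := variance_sum_pi hL
    congr 1
    convert h using 1
    · congr 1; ext x; simp
    · rw [Finset.sum_mul]
      refine Finset.sum_congr rfl fun i _ => ?_
      rw [variance_const_mul, variance_fun_id_gaussianReal]

lemma map_flip_pi_pi {ι κ : Type*} [Fintype ι] [Fintype κ] (ν : ι → κ → Measure ℝ)
    [∀ i j, IsProbabilityMeasure (ν i j)] :
    (Measure.pi fun i => Measure.pi fun j => ν i j).map (fun t j i => t i j) =
      Measure.pi fun j => Measure.pi fun i => ν i j := by
  simp only [← Measure.infinitePi_eq_pi]
  rw [← Measure.infinitePi_map_curry ν, ← Measure.infinitePi_map_curry fun j i => ν i j,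
    ← Measure.infinitePi_map_piCongrLeft (fun p : κ × ι => ν p.2 p.1) (Equiv.prodComm ι κ),
    Measure.map_map (by fun_prop) (by fun_prop), Measure.map_map (by fun_prop) (by fun_prop)]
  congr 1

lemma map_empMean {d N : ℕ} (hN : 0 < N) (σ : ℝ) (m : Fin d → ℝ) :
    (Measure.pi fun _ : Fin N => gaussVec σ m).map empMean =
      (Measure.pi fun _ : Fin d => gaussianReal 0 1).map
        (fun g i => m i + √(σ ^ 2 / N) * g i) := by
  have hN' : (0 : ℝ) < N := by exact_mod_cast hN
  have h1 : (empMean : (Fin N → Fin d → ℝ) → Fin d → ℝ) =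
      (fun u i => ∑ j, (N : ℝ)⁻¹ * u i j) ∘ (fun t i j => t j i) := by
    ext t i
    simp only [empMean, Function.comp, ← Finset.mul_sum]
    ring
  have e1 : (Measure.pi fun _ : Fin N => gaussVec σ m).map (fun t i j => t j i) =
      Measure.pi fun i => Measure.pi fun _ : Fin N => gaussianReal (m i) (σ ^ 2).toNNReal :=
    map_flip_pi_pi (fun (_ : Fin N) (i : Fin d) => gaussianReal (m i) (σ ^ 2).toNNReal)
  rw [h1, ← Measure.map_map (by fun_prop) (by fun_prop), e1,
    Measure.pi_map_pi (f := fun i (u : Fin N → ℝ) => ∑ j, (N : ℝ)⁻¹ * u j)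
      (fun i => (Finset.measurable_sum _ fun j _ =>
        (measurable_pi_apply j).const_mul _).aemeasurable),
    Measure.pi_map_pi (f := fun i (g : ℝ) => m i + √(σ ^ 2 / N) * g) (fun i => by fun_prop)]
  congr 1
  ext1 i
  rw [map_linear_pi_gaussianReal, map_stdGaussian _ _ (by positivity)]
  have : 0 ≤ σ ^ 2 := sq_nonneg σ
  congr 1
  · simp; field_simp
  · congr 1
    rw [Real.coe_toNNReal _ this]
    simp; field_simp

/-- The centred quadratic polynomial `A g + B (g² - 1)`. -/
def hermiteQuad (A B g : ℝ) : ℝ := A * g + B * (g ^ 2 - 1)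

lemma integrable_pow_stdGaussian (n : ℕ) : Integrable (fun g : ℝ => g ^ n) (gaussianReal 0 1) := by
  have h := (memLp_id_gaussianReal (μ := 0) (v := 1) n).integrable_norm_pow'
  refine (integrable_norm_iff (by fun_prop)).1 ?_
  simpa using h

lemma integral_cube_stdGaussian : ∫ g, g ^ 3 ∂gaussianReal 0 1 = 0 := by
  have h : ∫ g, g ^ 3 ∂gaussianReal 0 1 = ∫ g, (-g) ^ 3 ∂gaussianReal 0 1 := by
    conv_lhs => rw [← neg_zero, ← gaussianReal_map_neg]
    rw [integral_map (by fun_prop) (by fun_prop)]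
  simp only [Odd.neg_pow (show Odd 3 by decide), integral_neg] at h
  linarith

lemma integral_pow_four_stdGaussian : ∫ g, g ^ 4 ∂gaussianReal 0 1 = 3 := by
  have h := iteratedDeriv_mgf_zero (X := id) (μ := gaussianReal 0 1) (by simp) 4
  rw [mgf_id_gaussianReal] at h
  simp only [id, Pi.pow_apply] at h
  have e : ∀ t : ℝ, Real.exp (0 * t + ((1 : NNReal) : ℝ) * t ^ 2 / 2) = Real.exp (t ^ 2 / 2) := by
    intro t; simp
  simp only [e] at h
  have hf : ∀ t : ℝ, HasDerivAt (fun t => Real.exp (t ^ 2 / 2)) (t * Real.exp (t ^ 2 / 2)) t :=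
    fun t => (((hasDerivAt_pow 2 t).div_const 2).exp).congr_deriv (by simp; ring)
  have hp : ∀ (p : ℝ → ℝ) (p' : ℝ → ℝ), (∀ t, HasDerivAt p (p' t) t) →
      deriv (fun t => p t * Real.exp (t ^ 2 / 2)) =
        fun t => (p' t + t * p t) * Real.exp (t ^ 2 / 2) := fun p p' h => by
    ext t
    exact (((h t).fun_mul (hf t)).congr_deriv (by ring)).deriv
  have h1 : deriv (fun t : ℝ => Real.exp (t ^ 2 / 2)) = fun t => t * Real.exp (t ^ 2 / 2) :=
    funext fun t => (hf t).deriv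
  have h2 := hp (fun t => t) (fun _ => 1) fun t => hasDerivAt_id t
  have h3 := hp (fun t => 1 + t * t) (fun t => 2 * t) fun t =>
    (((hasDerivAt_id t).fun_mul (hasDerivAt_id t)).const_add 1).congr_deriv (by simp; ring)
  have h4 := hp (fun t => 2 * t + t * (1 + t * t)) (fun t => 3 + 3 * t ^ 2) fun t =>
    (((hasDerivAt_id t).const_mul 2).fun_add ((hasDerivAt_id t).fun_mul
      (((hasDerivAt_id t).fun_mul (hasDerivAt_id t)).const_add 1))).congr_deriv (by simp; ring)
  rw [← h, iteratedDeriv_succ', iteratedDeriv_succ', iteratedDeriv_succ', iteratedDeriv_one, h1, h2,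
    h3, h4]
  simp

lemma abs_hermiteQuad_le {A B R : ℝ} (hA : |A| ≤ R) (hB : |B| ≤ R) (g : ℝ) :
    |hermiteQuad A B g| ≤ 2 * R * (1 + g ^ 2) := by
  have h1 : |g| ≤ (1 + g ^ 2) / 2 := by
    rw [abs_le]; constructor <;> nlinarith [sq_nonneg (g - 1), sq_nonneg (g + 1)]
  have h2 : |g ^ 2 - 1| ≤ 1 + g ^ 2 := by
    rw [abs_le]; constructor <;> nlinarith [sq_nonneg g]
  have hR : 0 ≤ R := (abs_nonneg _).trans hA
  calc |hermiteQuad A B g| ≤ |A| * |g| + |B| * |g ^ 2 - 1| := by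
        rw [← abs_mul, ← abs_mul]; exact abs_add_le _ _
    _ ≤ R * ((1 + g ^ 2) / 2) + R * (1 + g ^ 2) := by gcongr
    _ ≤ _ := by nlinarith [mul_nonneg hR (sq_nonneg g)]

lemma integrable_hermiteQuad (A B : ℝ) : Integrable (hermiteQuad A B) (gaussianReal 0 1) := by
  have h1 := integrable_pow_stdGaussian 1
  simp only [pow_one] at h1
  exact (h1.const_mul A).add (((integrable_pow_stdGaussian 2).sub (integrable_const 1)).const_mul B)

lemma integral_hermiteQuad (A B : ℝ) : ∫ g, hermiteQuad A B g ∂gaussianReal 0 1 = 0 := by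
  have h1 := integrable_pow_stdGaussian 1
  simp only [pow_one] at h1
  have h2 : Integrable (fun g : ℝ => g ^ 2 - 1) (gaussianReal 0 1) :=
    (integrable_pow_stdGaussian 2).sub (integrable_const 1)
  simp only [hermiteQuad]
  rw [integral_add (h1.const_mul A) (h2.const_mul B), integral_const_mul, integral_const_mul]
  rw [integral_id_gaussianReal, integral_sub (integrable_pow_stdGaussian 2) (integrable_const 1),
    integral_sq_stdGaussian]
  simp

lemma integrable_hermiteQuad_sq (A B : ℝ) :
    Integrable (fun g => hermiteQuad A B g ^ 2) (gaussianReal 0 1) := by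
  have : (fun g => hermiteQuad A B g ^ 2) = fun g =>
      B ^ 2 * g ^ 4 + 2 * A * B * g ^ 3 + (A ^ 2 - 2 * B ^ 2) * g ^ 2 + (- 2 * A * B) * g ^ 1
        + B ^ 2 := by
    ext g; rw [hermiteQuad]; ring
  rw [this]
  have := integrable_pow_stdGaussian
  fun_prop

lemma integral_hermiteQuad_sq (A B : ℝ) :
    ∫ g, hermiteQuad A B g ^ 2 ∂gaussianReal 0 1 = A ^ 2 + 2 * B ^ 2 := by
  have e : (fun g => hermiteQuad A B g ^ 2) = fun g =>
      B ^ 2 * g ^ 4 + (2 * A * B * g ^ 3 + ((A ^ 2 - 2 * B ^ 2) * g ^ 2 + ((- 2 * A * B) * g ^ 1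
        + B ^ 2))) := by
    ext g; rw [hermiteQuad]; ring
  have := integrable_pow_stdGaussian
  have h1 : ∫ g, (-2 * A * B) * g ^ 1 ∂gaussianReal 0 1 = 0 := by
    rw [integral_const_mul]; simp
  rw [e, integral_add (by fun_prop) (by fun_prop), integral_add (by fun_prop) (by fun_prop),
    integral_add (by fun_prop) (by fun_prop), integral_add (by fun_prop) (by fun_prop), h1]
  simp only [integral_const_mul, integral_pow_four_stdGaussian, integral_cube_stdGaussian,
    integral_sq_stdGaussian, integral_const, probReal_univ,
    one_smul]
  ring

/-- The law of a pair of independent standard Gaussian variables. -/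
noncomputable abbrev stdPair : Measure (ℝ × ℝ) := (gaussianReal 0 1).prod (gaussianReal 0 1)

/-- The envelope dominating the quadratic polynomials below. -/
def quadEnvelope (w : ℝ × ℝ) : ℝ := 1 + w.1 ^ 2 + w.2 ^ 2

lemma memLp_sq_stdGaussian : MemLp (fun g : ℝ => g ^ 2) 3 (gaussianReal 0 1) := by
  have h := (memLp_stdGaussian 6).norm_rpow_div 2
  have e : ((6 : NNReal) : ENNReal) / 2 = 3 := by
    rw [ENNReal.coe_ofNat, ENNReal.div_eq_inv_mul, show (6 : ENNReal) = 2 * 3 by norm_num, ← mul_assoc,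
      ENNReal.inv_mul_cancel (by norm_num) (by norm_num), one_mul]
  rw [e] at h
  simpa using h

lemma memLp_quadEnvelope : MemLp quadEnvelope 3 stdPair := by
  have h1 : MemLp (fun w : ℝ × ℝ => w.1 ^ 2) 3 stdPair := memLp_sq_stdGaussian.comp_fst _
  have h2 : MemLp (fun w : ℝ × ℝ => w.2 ^ 2) 3 stdPair := memLp_sq_stdGaussian.comp_snd _
  have h0 : MemLp (fun _ : ℝ × ℝ => (1 : ℝ)) 3 stdPair := memLp_const 1
  exact (h0.add h1).add h2

lemma measurable_lowTail_comp {Ω : Type*} [MeasurableSpace Ω] {X V : Ω → ℝ} (hX : Measurable X)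
    (hV : Measurable V) : Measurable fun ω => lowTail (X ω) (V ω) := by
  have h : Measurable fun ω => gaussianReal (X ω) (V ω).toNNReal :=
    measurable_gaussianReal.comp (hX.prodMk hV.real_toNNReal)
  exact (Measure.measurable_measure.1 h (Iio 0) measurableSet_Iio).ennreal_toReal

lemma integrable_lowTail_comp {Ω : Type*} [MeasurableSpace Ω] {ν : Measure Ω} [IsFiniteMeasure ν]
    {X V : Ω → ℝ} (hX : Measurable X) (hV : Measurable V) :
    Integrable (fun ω => lowTail (X ω) (V ω)) ν := by
  refine Integrable.of_bound (measurable_lowTail_comp hX hV).aestronglyMeasurable 1 ?_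
  refine ae_of_all _ fun ω => ?_
  rw [Real.norm_of_nonneg (lowTail_nonneg _ _)]
  exact lowTail_le_one _ _

lemma integral_abs_le_sqrt_integral_sq {Ω : Type*} [MeasurableSpace Ω] {ν : Measure Ω}
    [IsProbabilityMeasure ν] {Y : Ω → ℝ} (hY : MemLp Y 2 ν) :
    ∫ ω, |Y ω| ∂ν ≤ √(∫ ω, Y ω ^ 2 ∂ν) := by
  have h := variance_nonneg (fun ω => |Y ω|) ν
  have hY' : MemLp (fun ω => |Y ω|) 2 ν := hY.abs
  rw [variance_eq_sub hY'] at h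
  simp only [Pi.pow_apply, sq_abs] at h
  exact Real.le_sqrt_of_sq_le (by linarith)

/-- Normal approximation for `lowTail` evaluated at independent sums, both the location and the
variance argument being random. -/
lemma abs_integral_lowTail_sum_sub_le {Ω : Type*} [MeasurableSpace Ω] {ν : Measure Ω}
    [IsProbabilityMeasure ν] {n : ℕ} (hn : 0 < n) {X W : Fin n → Ω → ℝ} {m s w : Fin n → ℝ}
    {κ K β : ℝ} (hκ : 0 < κ) (hXm : ∀ i, Measurable (X i)) (hX : ∀ i, MemLp (X i) 3 ν)
    (hm : ∀ i, ∫ ω, X i ω ∂ν = m i) (hs : ∀ i, ∫ ω, (X i ω - m i) ^ 2 ∂ν = s i)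
    (hβ : ∀ i, ∫ ω, |X i ω - m i| ^ 3 ∂ν + √(s i) ^ 3 * gaussAbsThird ≤ β)
    (hWm : ∀ i, Measurable (W i)) (hW : ∀ i, MemLp (W i) 2 ν)
    (hw : ∀ i, ∫ ω, W i ω ∂ν = w i) (hκw : ∀ i, κ ≤ w i)
    (hK : ∀ i, ∫ ω, (W i ω - w i) ^ 2 ∂ν ≤ K) :
    |∫ ω, lowTail (∑ i, X i (ω i)) (∑ i, W i (ω i)) ∂(Measure.pi fun _ : Fin n => ν) -
        lowTail (∑ i, m i) (∑ i, w i + ∑ i, s i)| ≤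
      (4 * √K / κ + 2 * β / √κ ^ 3) / √n := by
  have hn' : (0 : ℝ) < n := by exact_mod_cast hn
  set P := Measure.pi fun _ : Fin n => ν
  have hκ0 : n * κ ≤ ∑ i, w i := by
    simpa using Finset.sum_le_sum fun i (_ : i ∈ Finset.univ) => hκw i
  have hnκ : 0 < n * κ := by positivity
  have hw0 : 0 < ∑ i, w i := hnκ.trans_le hκ0
  have hXs : Measurable fun ω : Fin n → Ω => ∑ i, X i (ω i) := by fun_prop
  have hWs : Measurable fun ω : Fin n → Ω => ∑ i, W i (ω i) := by fun_prop
  have hWL : ∀ i, MemLp (fun ω : Fin n → Ω => W i (ω i)) 2 P := fun i =>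
    (hW i).comp_measurePreserving (measurePreserving_eval _ i)
  have hWsL : MemLp (fun ω : Fin n → Ω => ∑ i, W i (ω i)) 2 P :=
    memLp_finsetSum _ fun i _ => hWL i
  have hmean : ∫ ω, ∑ i, W i (ω i) ∂P = ∑ i, w i := by
    rw [integral_finsetSum _ fun i _ => (hWL i).integrable (by norm_num)]
    refine Finset.sum_congr rfl fun i _ => ?_
    rw [← hw i]
    exact integral_comp_eval (μ := fun _ : Fin n => ν) (hWm i).aestronglyMeasurable
  have hvar : ∫ ω, (∑ i, W i (ω i) - ∑ i, w i) ^ 2 ∂P ≤ n * K := by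
    have ha : ∀ i, AEMeasurable (fun ω : Fin n → Ω => W i (ω i)) P := fun i =>
      ((hWm i).comp (measurable_pi_apply i)).aemeasurable
    have h1 := variance_sum_pi (μ := fun _ : Fin n => ν) hW
    rw [variance_eq_integral (Finset.aemeasurable_sum _ fun i _ => ha i)] at h1
    simp only [Finset.sum_apply] at h1
    change ∫ ω, (∑ i, W i (ω i) - ∫ ω, ∑ i, W i (ω i) ∂P) ^ 2 ∂P = _ at h1
    rw [hmean] at h1
    rw [h1]
    refine (Finset.sum_le_card_nsmul _ _ K fun i _ => ?_).trans_eq (by simp)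
    rw [variance_eq_integral (hWm i).aemeasurable, hw]
    exact hK i
  have hstep1 : |∫ ω, lowTail (∑ i, X i (ω i)) (∑ i, W i (ω i)) ∂P -
      ∫ ω, lowTail (∑ i, X i (ω i)) (∑ i, w i) ∂P| ≤ 4 * √K / κ / √n := by
    rw [← integral_sub (integrable_lowTail_comp hXs hWs)
      (integrable_lowTail_comp hXs measurable_const)]
    have hd : MemLp (fun ω : Fin n → Ω => ∑ i, W i (ω i) - ∑ i, w i) 2 P :=
      hWsL.sub (memLp_const _)
    calc _ ≤ ∫ ω, |lowTail (∑ i, X i (ω i)) (∑ i, W i (ω i)) -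
          lowTail (∑ i, X i (ω i)) (∑ i, w i)| ∂P := abs_integral_le_integral_abs
      _ ≤ ∫ ω, 4 / (∑ i, w i) * |∑ i, W i (ω i) - ∑ i, w i| ∂P :=
          integral_mono ((integrable_lowTail_comp hXs hWs).sub
            (integrable_lowTail_comp hXs measurable_const)).abs
            ((hd.integrable (by norm_num)).abs.const_mul _)
            fun ω => abs_lowTail_sub_le _ hw0
      _ ≤ 4 / (n * κ) * √(n * K) := by
          rw [integral_const_mul]
          have := (integral_abs_le_sqrt_integral_sq hd).trans (Real.sqrt_le_sqrt hvar)
          gcongr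
      _ = _ := by
          rw [Real.sqrt_mul hn'.le]
          field_simp
          rw [Real.sq_sqrt hn'.le]
  have hstep2 := lindeberg_lowTail ν hnκ X m s hXm hX hm hs hβ hκ0 0
  simp only [zero_add] at hstep2
  have e : n * (2 / √(n * κ) ^ 3 * β) = 2 * β / √κ ^ 3 / √n := by
    rw [Real.sqrt_mul hn'.le]
    have : √(n : ℝ) ^ 2 = n := Real.sq_sqrt hn'.le
    field_simp
    rw [this]
  rw [e] at hstep2
  rw [add_div]
  exact (abs_sub_le _ _ _).trans (add_le_add hstep1 hstep2)

/-- Difference of the squares of two independent Gaussian variables with means `p`, `q` and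
variances `b`, `a`. -/
noncomputable def squareDiff (a b p q : ℝ) (w : ℝ × ℝ) : ℝ := (p + √b * w.2) ^ 2 - (q + √a * w.1) ^ 2

/-- Square of the difference of two independent Gaussian variables with variances `b`, `a`, the
difference of their means being `r`. -/
noncomputable def diffSquare (a b r : ℝ) (w : ℝ × ℝ) : ℝ := (r + √b * w.2 - √a * w.1) ^ 2

lemma measurable_squareDiff (a b p q : ℝ) : Measurable (squareDiff a b p q) := by
  unfold squareDiff; fun_prop

lemma measurable_diffSquare (a b r : ℝ) : Measurable (diffSquare a b r) := by
  unfold diffSquare; fun_prop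

lemma squareDiff_sub {a b : ℝ} (ha : 0 ≤ a) (hb : 0 ≤ b) (p q : ℝ) (w : ℝ × ℝ) :
    squareDiff a b p q w - (p ^ 2 + b - q ^ 2 - a) =
      hermiteQuad (2 * p * √b) b w.2 - hermiteQuad (2 * q * √a) a w.1 := by
  simp only [squareDiff, hermiteQuad]
  linear_combination w.2 ^ 2 * Real.sq_sqrt hb - w.1 ^ 2 * Real.sq_sqrt ha

lemma diffSquare_sub {a b : ℝ} (ha : 0 ≤ a) (hb : 0 ≤ b) (r : ℝ) (w : ℝ × ℝ) :
    diffSquare a b r w - (r ^ 2 + a + b) =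
      hermiteQuad (2 * r * √b) b w.2 + hermiteQuad (-(2 * r * √a)) a w.1 -
        2 * √a * √b * (w.1 * w.2) := by
  simp only [diffSquare, hermiteQuad]
  linear_combination w.2 ^ 2 * Real.sq_sqrt hb + w.1 ^ 2 * Real.sq_sqrt ha

lemma one_le_quadEnvelope (w : ℝ × ℝ) : 1 ≤ quadEnvelope w := by
  unfold quadEnvelope; nlinarith [sq_nonneg w.1, sq_nonneg w.2]

lemma memLp_of_abs_le_quadEnvelope {Y : ℝ × ℝ → ℝ} (hY : Measurable Y) {k : ℝ}
    (h : ∀ w, |Y w| ≤ k * quadEnvelope w) : MemLp Y 3 stdPair := by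
  refine memLp_quadEnvelope.of_le_mul hY.aestronglyMeasurable (c := k) (ae_of_all _ fun w => ?_)
  rw [Real.norm_eq_abs, Real.norm_of_nonneg (zero_le_one.trans (one_le_quadEnvelope w))]
  exact h w

lemma integral_abs_pow_le_of_abs_le_quadEnvelope {Y : ℝ × ℝ → ℝ} {k : ℝ}
    (h : ∀ w, |Y w| ≤ k * quadEnvelope w) {n : ℕ} (hn : n ≠ 0) (hn3 : n ≤ 3) :
    ∫ w, |Y w| ^ n ∂stdPair ≤ k ^ n * ∫ w, quadEnvelope w ^ n ∂stdPair := by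
  rw [← integral_const_mul]
  have hE : MemLp quadEnvelope n stdPair := memLp_quadEnvelope.mono_exponent (by exact_mod_cast hn3)
  have hi : Integrable (fun w => quadEnvelope w ^ n) stdPair := by
    refine (hE.integrable_norm_pow hn).congr (ae_of_all _ fun w => ?_)
    simp only
    rw [Real.norm_of_nonneg (zero_le_one.trans (one_le_quadEnvelope w))]
  refine integral_mono_of_nonneg (ae_of_all _ fun w => by positivity) (hi.const_mul _)
    (ae_of_all _ fun w => ?_)
  simp only
  rw [← mul_pow]
  exact pow_le_pow_left₀ (abs_nonneg _) (h w) n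

lemma integrable_hermiteQuad_fst (A B : ℝ) :
    Integrable (fun w : ℝ × ℝ => hermiteQuad A B w.1) stdPair :=
  (integrable_hermiteQuad A B).comp_fst _

lemma integrable_hermiteQuad_snd (A B : ℝ) :
    Integrable (fun w : ℝ × ℝ => hermiteQuad A B w.2) stdPair :=
  (integrable_hermiteQuad A B).comp_snd _

lemma integral_squareDiff {a b : ℝ} (ha : 0 ≤ a) (hb : 0 ≤ b) (p q : ℝ) :
    ∫ w, squareDiff a b p q w ∂stdPair = p ^ 2 + b - q ^ 2 - a := by
  have e : squareDiff a b p q = fun w => (hermiteQuad (2 * p * √b) b w.2 -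
      hermiteQuad (2 * q * √a) a w.1) + (p ^ 2 + b - q ^ 2 - a) := by
    ext w; rw [← squareDiff_sub ha hb]; ring
  have i1 : Integrable (fun w : ℝ × ℝ => hermiteQuad (2 * p * √b) b w.2 -
      hermiteQuad (2 * q * √a) a w.1) stdPair :=
    (integrable_hermiteQuad_snd _ _).sub (integrable_hermiteQuad_fst _ _)
  rw [e, integral_add i1 (integrable_const _),
    integral_sub (integrable_hermiteQuad_snd _ _) (integrable_hermiteQuad_fst _ _),
    integral_fun_fst, integral_fun_snd]
  simp [integral_hermiteQuad]

lemma integral_squareDiff_sub_sq {a b : ℝ} (ha : 0 ≤ a) (hb : 0 ≤ b) (p q : ℝ) :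
    ∫ w, (squareDiff a b p q w - (p ^ 2 + b - q ^ 2 - a)) ^ 2 ∂stdPair =
      4 * p ^ 2 * b + 2 * b ^ 2 + (4 * q ^ 2 * a + 2 * a ^ 2) := by
  simp only [squareDiff_sub ha hb]
  set H := hermiteQuad (2 * p * √b) b
  set G := hermiteQuad (2 * q * √a) a
  have iH : Integrable (fun w : ℝ × ℝ => H w.2 ^ 2) stdPair :=
    (integrable_hermiteQuad_sq _ _).comp_snd _
  have iG : Integrable (fun w : ℝ × ℝ => G w.1 ^ 2) stdPair :=
    (integrable_hermiteQuad_sq _ _).comp_fst _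
  have iGH : Integrable (fun w : ℝ × ℝ => G w.1 * H w.2) stdPair :=
    (integrable_hermiteQuad _ _).mul_prod (integrable_hermiteQuad _ _)
  have e : ∀ w : ℝ × ℝ, (H w.2 - G w.1) ^ 2 =
      (H w.2 ^ 2 + G w.1 ^ 2) - 2 * (G w.1 * H w.2) := fun w => by ring
  simp only [e]
  have iS : Integrable (fun w : ℝ × ℝ => H w.2 ^ 2 + G w.1 ^ 2) stdPair := iH.add iG
  rw [integral_sub iS (iGH.const_mul 2), integral_add iH iG, integral_const_mul,
    integral_prod_mul, integral_fun_fst (f := fun x => G x ^ 2),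
    integral_fun_snd (f := fun x => H x ^ 2)]
  simp only [H, G, integral_hermiteQuad, integral_hermiteQuad_sq, probReal_univ, one_smul]
  linear_combination 4 * p ^ 2 * Real.sq_sqrt hb + 4 * q ^ 2 * Real.sq_sqrt ha

lemma integral_diffSquare {a b : ℝ} (ha : 0 ≤ a) (hb : 0 ≤ b) (r : ℝ) :
    ∫ w, diffSquare a b r w ∂stdPair = r ^ 2 + a + b := by
  have e : diffSquare a b r = fun w => (hermiteQuad (2 * r * √b) b w.2 +
      hermiteQuad (-(2 * r * √a)) a w.1 - 2 * √a * √b * (w.1 * w.2)) + (r ^ 2 + a + b) := by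
    ext w; rw [← diffSquare_sub ha hb]; ring
  have hg : Integrable (fun g : ℝ => g) (gaussianReal 0 1) := by
    simpa using integrable_pow_stdGaussian 1
  have iP : Integrable (fun w : ℝ × ℝ => 2 * √a * √b * (w.1 * w.2)) stdPair :=
    (hg.mul_prod hg).const_mul _
  have iH := integrable_hermiteQuad_snd (2 * r * √b) b
  have iG := integrable_hermiteQuad_fst (-(2 * r * √a)) a
  have i1 : Integrable (fun w : ℝ × ℝ => hermiteQuad (2 * r * √b) b w.2 +
      hermiteQuad (-(2 * r * √a)) a w.1) stdPair := iH.add iG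
  have i2 : Integrable (fun w : ℝ × ℝ => hermiteQuad (2 * r * √b) b w.2 +
      hermiteQuad (-(2 * r * √a)) a w.1 - 2 * √a * √b * (w.1 * w.2)) stdPair := i1.sub iP
  rw [e, integral_add i2 (integrable_const _), integral_sub i1 iP, integral_add iH iG,
    integral_const_mul, integral_prod_mul (fun x : ℝ => x) (fun x : ℝ => x), integral_fun_fst,
    integral_fun_snd]
  simp [integral_hermiteQuad]

lemma exists_abs_squareDiff_sub_le {a b : ℝ} (ha : 0 ≤ a) (hb : 0 ≤ b) (R : ℝ) :
    ∃ k, 0 ≤ k ∧ ∀ p q w, |p| ≤ R → |q| ≤ R →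
      |squareDiff a b p q w - (p ^ 2 + b - q ^ 2 - a)| ≤ k * quadEnvelope w := by
  by_cases hR : 0 ≤ R
  swap
  · exact ⟨0, le_rfl, fun p _ _ hp _ => absurd ((abs_nonneg p).trans hp) hR⟩
  set L := 2 * R * √b + b + 2 * R * √a + a with hL
  have l1 : 0 ≤ 2 * R * √b := by positivity
  have l2 : 0 ≤ 2 * R * √a := by positivity
  refine ⟨4 * L, by positivity, fun p q w hp hq => ?_⟩
  rw [squareDiff_sub ha hb]
  have h1 := abs_hermiteQuad_le (A := 2 * p * √b) (B := b) (R := L)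
    (by
      rw [abs_mul, abs_mul, abs_two, abs_of_nonneg (Real.sqrt_nonneg b)]
      have : 2 * |p| * √b ≤ 2 * R * √b := by gcongr
      linarith) (by rw [abs_of_nonneg hb]; linarith) w.2
  have h2 := abs_hermiteQuad_le (A := 2 * q * √a) (B := a) (R := L)
    (by
      rw [abs_mul, abs_mul, abs_two, abs_of_nonneg (Real.sqrt_nonneg a)]
      have : 2 * |q| * √a ≤ 2 * R * √a := by gcongr
      linarith) (by rw [abs_of_nonneg ha]; linarith) w.1
  refine (abs_sub _ _).trans ((add_le_add h1 h2).trans ?_)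
  have hL0 : 0 ≤ L := by positivity
  unfold quadEnvelope
  nlinarith [mul_nonneg hL0 (sq_nonneg w.1), mul_nonneg hL0 (sq_nonneg w.2)]

lemma exists_abs_diffSquare_sub_le {a b : ℝ} (ha : 0 ≤ a) (hb : 0 ≤ b) (R : ℝ) :
    ∃ k, 0 ≤ k ∧ ∀ r w, |r| ≤ R →
      |diffSquare a b r w - (r ^ 2 + a + b)| ≤ k * quadEnvelope w := by
  by_cases hR : 0 ≤ R
  swap
  · exact ⟨0, le_rfl, fun p _ hp => absurd ((abs_nonneg p).trans hp) hR⟩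
  set L := 2 * R * √b + b + 2 * R * √a + a with hL
  have l1 : 0 ≤ 2 * R * √b := by positivity
  have l2 : 0 ≤ 2 * R * √a := by positivity
  refine ⟨4 * L + √a * √b, by positivity, fun r w hr => ?_⟩
  rw [diffSquare_sub ha hb]
  have h1 := abs_hermiteQuad_le (A := 2 * r * √b) (B := b) (R := L)
    (by
      rw [abs_mul, abs_mul, abs_two, abs_of_nonneg (Real.sqrt_nonneg b)]
      have : 2 * |r| * √b ≤ 2 * R * √b := by gcongr
      linarith) (by rw [abs_of_nonneg hb]; linarith) w.2
  have h2 := abs_hermiteQuad_le (A := -(2 * r * √a)) (B := a) (R := L)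
    (by
      rw [abs_neg, abs_mul, abs_mul, abs_two, abs_of_nonneg (Real.sqrt_nonneg a)]
      have : 2 * |r| * √a ≤ 2 * R * √a := by gcongr
      linarith) (by rw [abs_of_nonneg ha]; linarith) w.1
  have h3 : |2 * √a * √b * (w.1 * w.2)| ≤ √a * √b * quadEnvelope w := by
    have : |2 * (w.1 * w.2)| ≤ quadEnvelope w := by
      unfold quadEnvelope
      rw [abs_le]
      constructor <;> nlinarith [sq_nonneg (w.1 - w.2), sq_nonneg (w.1 + w.2)]
    calc _ = √a * √b * |2 * (w.1 * w.2)| := by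
          conv_rhs => rw [← abs_of_nonneg (show 0 ≤ √a * √b by positivity), ← abs_mul]
          congr 1; ring
      _ ≤ _ := by gcongr
  refine (abs_sub _ _).trans ((add_le_add ((abs_add_le _ _).trans (add_le_add h1 h2)) h3).trans ?_)
  have hL0 : 0 ≤ L := by positivity
  rw [add_mul]
  gcongr
  unfold quadEnvelope
  nlinarith [mul_nonneg hL0 (sq_nonneg w.1), mul_nonneg hL0 (sq_nonneg w.2)]

/-- Normal approximation of the conditional error probability, uniformly over bounded means. -/
lemma exists_abs_integral_lowTail_sub_le {a b c : ℝ} (ha : 0 < a) (hb : 0 < b) (hc : 0 < c)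
    (R : ℝ) :
    ∃ C, 0 ≤ C ∧ ∀ d : ℕ, 1 ≤ d → ∀ p q r : Fin d → ℝ, (∀ i, |p i| ≤ R) → (∀ i, |q i| ≤ R) →
      (∀ i, |r i| ≤ R) →
      |∫ ω, lowTail (∑ i, squareDiff a b (p i) (q i) (ω i))
          (∑ i, c * diffSquare a b (r i) (ω i)) ∂(Measure.pi fun _ : Fin d => stdPair) -
        lowTail (∑ i, (p i ^ 2 + b - q i ^ 2 - a)) (∑ i, c * (r i ^ 2 + a + b) +
          ∑ i, (4 * p i ^ 2 * b + 2 * b ^ 2 + (4 * q i ^ 2 * a + 2 * a ^ 2)))| ≤ C / √d := by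
  obtain ⟨k, hk, hX⟩ := exists_abs_squareDiff_sub_le ha.le hb.le R
  obtain ⟨l, hl, hW⟩ := exists_abs_diffSquare_sub_le ha.le hb.le R
  set E2 := ∫ w, quadEnvelope w ^ 2 ∂stdPair
  set E3 := ∫ w, quadEnvelope w ^ 3 ∂stdPair
  have hE3 : 0 ≤ E3 := integral_nonneg fun w =>
    pow_nonneg (zero_le_one.trans (one_le_quadEnvelope w)) 3
  have hG : 0 ≤ gaussAbsThird := integral_nonneg fun _ => by positivity
  set β := k ^ 3 * E3 + √(k ^ 2 * E2) ^ 3 * gaussAbsThird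
  have hκ : 0 < c * (a + b) := by positivity
  refine ⟨4 * √((c * l) ^ 2 * E2) / (c * (a + b)) + 2 * β / √(c * (a + b)) ^ 3, by positivity,
    fun d hd p q r hp hq hr => ?_⟩
  have hX' := fun i w => hX (p i) (q i) w (hp i) (hq i)
  have hW' : ∀ i w, |c * diffSquare a b (r i) w - c * (r i ^ 2 + a + b)| ≤
      c * l * quadEnvelope w := fun i w => by
    rw [← mul_sub, abs_mul, abs_of_pos hc, mul_assoc]
    exact mul_le_mul_of_nonneg_left (hW _ _ (hr i)) hc.le
  have hXm : ∀ i, Measurable (squareDiff a b (p i) (q i)) := fun i => measurable_squareDiff _ _ _ _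
  have hWm : ∀ i, Measurable fun w => c * diffSquare a b (r i) w := fun i =>
    (measurable_diffSquare _ _ _).const_mul c
  have hX3 : ∀ i, MemLp (squareDiff a b (p i) (q i)) 3 stdPair := fun i => by
    have h := (memLp_of_abs_le_quadEnvelope ((hXm i).sub_const _) (hX' i)).add
      (memLp_const (p i ^ 2 + b - q i ^ 2 - a))
    refine h.ae_eq (ae_of_all _ fun w => ?_)
    simp
  have hW3 : ∀ i, MemLp (fun w => c * diffSquare a b (r i) w) 3 stdPair := fun i => by
    have h := (memLp_of_abs_le_quadEnvelope ((hWm i).sub_const _) (hW' i)).add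
      (memLp_const (c * (r i ^ 2 + a + b)))
    refine h.ae_eq (ae_of_all _ fun w => ?_)
    simp
  refine abs_integral_lowTail_sum_sub_le (X := fun i => squareDiff a b (p i) (q i))
    (W := fun i w => c * diffSquare a b (r i) w) (m := fun i => p i ^ 2 + b - q i ^ 2 - a)
    (s := fun i => 4 * p i ^ 2 * b + 2 * b ^ 2 + (4 * q i ^ 2 * a + 2 * a ^ 2))
    (w := fun i => c * (r i ^ 2 + a + b)) hd hκ hXm hX3
    (fun i => integral_squareDiff ha.le hb.le _ _)
    (fun i => integral_squareDiff_sub_sq ha.le hb.le _ _) (fun i => ?_) hWm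
    (fun i => (hW3 i).mono_exponent (by norm_num)) (fun i => ?_) (fun i => ?_) (fun i => ?_)
  · refine add_le_add (integral_abs_pow_le_of_abs_le_quadEnvelope (hX' i) (by norm_num) le_rfl) ?_
    rw [← integral_squareDiff_sub_sq ha.le hb.le]
    gcongr
    simpa using integral_abs_pow_le_of_abs_le_quadEnvelope (hX' i) two_ne_zero (by norm_num)
  · rw [integral_const_mul, integral_diffSquare ha.le hb.le]
  · gcongr
    nlinarith [sq_nonneg (r i)]
  · simpa using integral_abs_pow_le_of_abs_le_quadEnvelope (hW' i) two_ne_zero (by norm_num)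

instance {d : ℕ} (σ : ℝ) (m : Fin d → ℝ) : IsProbabilityMeasure (gaussVec σ m) := by
  unfold gaussVec; infer_instance

lemma measurable_eDist {d : ℕ} : Measurable fun p : (Fin d → ℝ) × (Fin d → ℝ) => eDist p.1 p.2 := by
  unfold eDist; fun_prop

lemma measurable_empMean {d n : ℕ} : Measurable (empMean : (Fin n → Fin d → ℝ) → Fin d → ℝ) := by
  unfold empMean; fun_prop

lemma gaussVec_eDist_lt {d : ℕ} (σ : ℝ) (m A B : Fin d → ℝ) :
    gaussVec σ m {x | ¬ eDist x A ≤ eDist x B} =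
      ENNReal.ofReal (lowTail (∑ i, ((B i - m i) ^ 2 - (A i - m i) ^ 2))
        (∑ i, 4 * σ ^ 2 * (B i - A i) ^ 2)) := by
  have hset : {x | ¬ eDist x A ≤ eDist x B} =
      (fun x => ∑ i, 2 * (A i - B i) * x i) ⁻¹'
        ((fun y => ∑ i, (B i ^ 2 - A i ^ 2) + y) ⁻¹' Iio 0) := by
    ext x
    simp only [mem_ofPred_eq, not_le, mem_preimage, mem_Iio, eDist]
    rw [Real.sqrt_lt_sqrt_iff (Finset.sum_nonneg fun i _ => sq_nonneg _), ← sub_neg,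
      ← Finset.sum_sub_distrib, ← Finset.sum_add_distrib]
    refine iff_of_eq (congrArg (· < 0) (Finset.sum_congr rfl fun i _ => ?_))
    ring
  have hmean : ∑ i, (B i ^ 2 - A i ^ 2) + ∑ i, 2 * (A i - B i) * m i =
      ∑ i, ((B i - m i) ^ 2 - (A i - m i) ^ 2) := by
    rw [← Finset.sum_add_distrib]
    exact Finset.sum_congr rfl fun i _ => by ring
  have hvar : (∑ i, (2 * (A i - B i)) ^ 2) * ((σ ^ 2).toNNReal : ℝ) =
      ∑ i, 4 * σ ^ 2 * (B i - A i) ^ 2 := by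
    rw [Real.coe_toNNReal _ (sq_nonneg σ), Finset.sum_mul]
    exact Finset.sum_congr rfl fun i _ => by ring
  rw [hset, lowTail, ← Measure.map_apply (by fun_prop) (measurableSet_Iio.preimage (by fun_prop)),
    gaussVec, map_linear_pi_gaussianReal, ← Measure.map_apply (by fun_prop) measurableSet_Iio,
    gaussianReal_map_const_add, add_comm, hmean, hvar, ofReal_measureReal]

lemma measurableSet_eDist_empMean_le {d N₁ N₂ : ℕ} :
    MeasurableSet {p : ((Fin N₁ → Fin d → ℝ) × (Fin N₂ → Fin d → ℝ)) × (Fin d → ℝ) |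
      eDist p.2 (empMean p.1.1) ≤ eDist p.2 (empMean p.1.2)} :=
  measurableSet_le
    (measurable_eDist.comp (measurable_snd.prodMk
      (measurable_empMean.comp (measurable_fst.comp measurable_fst))))
    (measurable_eDist.comp (measurable_snd.prodMk
      (measurable_empMean.comp (measurable_snd.comp measurable_fst))))

/-- The probability that a test point with mean `m` is assigned to the second class, as an average
of `lowTail` over the fluctuations of the two empirical means. -/
lemma toReal_measure_not_eDist_le {d N₁ N₂ : ℕ} (hN₁ : 0 < N₁) (hN₂ : 0 < N₂) (σ : ℝ)
    (μ m : Fin d → ℝ) :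
    ((((Measure.pi fun _ : Fin N₁ => gaussVec σ (-μ)).prod
            (Measure.pi fun _ : Fin N₂ => gaussVec σ μ)).prod (gaussVec σ m))
        {p : ((Fin N₁ → Fin d → ℝ) × (Fin N₂ → Fin d → ℝ)) × (Fin d → ℝ) |
          ¬ eDist p.2 (empMean p.1.1) ≤ eDist p.2 (empMean p.1.2)}).toReal =
      ∫ ω, lowTail (∑ i, squareDiff (σ ^ 2 / N₁) (σ ^ 2 / N₂) (μ i - m i) (-μ i - m i) (ω i))
        (∑ i, 4 * σ ^ 2 * diffSquare (σ ^ 2 / N₁) (σ ^ 2 / N₂) (2 * μ i) (ω i))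
        ∂(Measure.pi fun _ : Fin d => stdPair) := by
  set a := σ ^ 2 / N₁
  set b := σ ^ 2 / N₂
  set F : (Fin d → ℝ) × (Fin d → ℝ) → ENNReal := fun p =>
    gaussVec σ m {x | ¬ eDist x p.1 ≤ eDist x p.2}
  have hF : Measurable F := by
    have hS : MeasurableSet {q : ((Fin d → ℝ) × (Fin d → ℝ)) × (Fin d → ℝ) |
        ¬ eDist q.2 q.1.1 ≤ eDist q.2 q.1.2} :=
      (measurableSet_le (measurable_eDist.comp (by fun_prop : Measurable fun q :
          ((Fin d → ℝ) × (Fin d → ℝ)) × (Fin d → ℝ) => (q.2, q.1.1)))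
        (measurable_eDist.comp (by fun_prop : Measurable fun q :
          ((Fin d → ℝ) × (Fin d → ℝ)) × (Fin d → ℝ) => (q.2, q.1.2)))).compl
    exact measurable_measure_prodMk_left hS
  have hFeq : ∀ ω : Fin d → ℝ × ℝ,
      F (fun i => (-μ) i + √a * (ω i).1, fun i => μ i + √b * (ω i).2) =
      ENNReal.ofReal (lowTail (∑ i, squareDiff a b (μ i - m i) (-μ i - m i) (ω i))
        (∑ i, 4 * σ ^ 2 * diffSquare a b (2 * μ i) (ω i))) := fun ω => by
    simp only [F, gaussVec_eDist_lt, squareDiff, diffSquare, Pi.neg_apply]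
    congr 2 <;> exact Finset.sum_congr rfl fun i _ => by ring
  have hφ : ∀ (e : Fin d → ℝ) (s : ℝ), Measurable fun (g : Fin d → ℝ) i => e i + s * g i :=
    fun e s => by fun_prop
  have hL : Measurable fun ω : Fin d → ℝ × ℝ =>
      lowTail (∑ i, squareDiff a b (μ i - m i) (-μ i - m i) (ω i))
        (∑ i, 4 * σ ^ 2 * diffSquare a b (2 * μ i) (ω i)) :=
    measurable_lowTail_comp
      (Finset.measurable_sum _ fun i _ => (measurable_squareDiff _ _ _ _).comp (measurable_pi_apply i))
      (Finset.measurable_sum _ fun i _ => ((measurable_diffSquare _ _ _).comp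
        (measurable_pi_apply i)).const_mul _)
  have hT : MeasurableSet {p : ((Fin N₁ → Fin d → ℝ) × (Fin N₂ → Fin d → ℝ)) × (Fin d → ℝ) |
      ¬ eDist p.2 (empMean p.1.1) ≤ eDist p.2 (empMean p.1.2)} :=
    measurableSet_eDist_empMean_le.compl
  rw [Measure.prod_apply hT, integral_eq_lintegral_of_nonneg_ae
    (ae_of_all _ fun ω => lowTail_nonneg _ _)
    hL.aestronglyMeasurable]
  simp only [← hFeq]
  congr 1
  calc _ = ∫⁻ t, F (Prod.map empMean empMean t) ∂((Measure.pi fun _ : Fin N₁ => gaussVec σ (-μ)).prod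
            (Measure.pi fun _ : Fin N₂ => gaussVec σ μ)) := rfl
    _ = ∫⁻ t, F t ∂(((Measure.pi fun _ : Fin N₁ => gaussVec σ (-μ)).map empMean).prod
          ((Measure.pi fun _ : Fin N₂ => gaussVec σ μ).map empMean)) := by
        rw [Measure.map_prod_map _ _ measurable_empMean measurable_empMean,
          lintegral_map hF (measurable_empMean.prodMap measurable_empMean)]
    _ = ∫⁻ g, F (fun i => (-μ) i + √a * g.1 i, fun i => μ i + √b * g.2 i)
          ∂((Measure.pi fun _ : Fin d => gaussianReal 0 1).prod
            (Measure.pi fun _ : Fin d => gaussianReal 0 1)) := by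
        rw [map_empMean hN₁, map_empMean hN₂, Measure.map_prod_map _ _ (hφ _ _) (hφ _ _),
          lintegral_map hF ((hφ _ _).prodMap (hφ _ _))]
        rfl
    _ = _ := by
        rw [← (measurePreserving_arrowProdEquivProdArrow ℝ ℝ (Fin d)
          (fun _ => gaussianReal 0 1) fun _ => gaussianReal 0 1).lintegral_comp_emb
          (MeasurableEquiv.measurableEmbedding _)]
        rfl

lemma errProb_eq {d N₁ N₂ : ℕ} (hN₁ : 0 < N₁) (hN₂ : 0 < N₂) (σ : ℝ) (μ : Fin d → ℝ) :
    errProb σ N₁ N₂ μ =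
      (1 / 2) * ∫ ω, lowTail
          (∑ i, squareDiff (σ ^ 2 / N₁) (σ ^ 2 / N₂) (μ i - (-μ) i) (-μ i - (-μ) i) (ω i))
          (∑ i, 4 * σ ^ 2 * diffSquare (σ ^ 2 / N₁) (σ ^ 2 / N₂) (2 * μ i) (ω i))
          ∂(Measure.pi fun _ : Fin d => stdPair) +
      (1 / 2) * (1 - ∫ ω, lowTail
          (∑ i, squareDiff (σ ^ 2 / N₁) (σ ^ 2 / N₂) (μ i - μ i) (-μ i - μ i) (ω i))
          (∑ i, 4 * σ ^ 2 * diffSquare (σ ^ 2 / N₁) (σ ^ 2 / N₂) (2 * μ i) (ω i))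
          ∂(Measure.pi fun _ : Fin d => stdPair)) := by
  rw [errProb, ← toReal_measure_not_eDist_le hN₁ hN₂, ← toReal_measure_not_eDist_le hN₁ hN₂]
  congr 2
  have h := probReal_compl_eq_one_sub (μ := ((Measure.pi fun _ : Fin N₁ => gaussVec σ (-μ)).prod
    (Measure.pi fun _ : Fin N₂ => gaussVec σ μ)).prod (gaussVec σ μ))
    (measurableSet_eDist_empMean_le (d := d) (N₁ := N₁) (N₂ := N₂)).compl
  rw [compl_compl] at h
  exact h

lemma lowTail_sq_mul {k D : ℝ} (hk : 0 < k) (hD : 0 < D) (z : ℝ) :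
    lowTail (k * z) (k ^ 2 * D) = gaussQ (z / √D) := by
  rw [lowTail_eq _ (by positivity), Real.sqrt_mul (sq_nonneg k), Real.sqrt_sq hk.le,
    mul_div_mul_left _ _ hk.ne']

lemma phat_zero (N γ q : ℝ) : phat 0 N γ q = 1 / 2 := by
  simp only [phat, Real.sqrt_zero, div_zero, mul_zero, add_zero, sub_zero, zero_div, gaussQ_zero]
  norm_num

lemma phat_eq_lowTail {σ T n₁ n₂ q : ℝ} (hσ : 0 < σ) (hT : 0 < T) (h₁ : 0 < n₁) (h₂ : 0 < n₂)
    (hq : 0 ≤ q) :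
    phat (T / σ ^ 2) n₁ (n₂ / n₁) q =
      (1 / 2) * lowTail (4 * T + q * (σ ^ 2 / n₂ - σ ^ 2 / n₁))
        (4 * σ ^ 2 * (4 * T + q * (σ ^ 2 / n₁ + σ ^ 2 / n₂)) + 16 * T * (σ ^ 2 / n₂) +
          q * (2 * (σ ^ 2 / n₁) ^ 2 + 2 * (σ ^ 2 / n₂) ^ 2)) +
      (1 / 2) * (1 - lowTail (-(4 * T) + q * (σ ^ 2 / n₂ - σ ^ 2 / n₁))
        (4 * σ ^ 2 * (4 * T + q * (σ ^ 2 / n₁ + σ ^ 2 / n₂)) + 16 * T * (σ ^ 2 / n₁) +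
          q * (2 * (σ ^ 2 / n₁) ^ 2 + 2 * (σ ^ 2 / n₂) ^ 2))) := by
  obtain ⟨r, hr, rfl⟩ : ∃ r, 0 < r ∧ T = σ ^ 2 * r ^ 2 :=
    ⟨√T / σ, by positivity, by rw [div_pow, Real.sq_sqrt hT.le]; field_simp⟩
  have hS : σ ^ 2 * r ^ 2 / σ ^ 2 = r ^ 2 := by field_simp
  have hk : 0 < 4 * σ ^ 2 * r := by positivity
  rw [hS, phat, Real.sqrt_sq hr.le]
  congr 2
  · rw [← lowTail_sq_mul hk (by positivity)]
    congr 1 <;> field_simp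
    ring
  · rw [eq_sub_iff_add_eq, ← eq_sub_iff_add_eq', ← gaussQ_neg, ← neg_div,
      ← lowTail_sq_mul hk (by positivity)]
    congr 1
    · field_simp; ring
    · field_simp; ring

theorem error_prob_approximation (σ M : ℝ) (hσ : 0 < σ) (hM : 0 < M)
    (N₁ N₂ : ℕ) (hN₁ : 0 < N₁) (hN₂ : 0 < N₂) (hle : N₂ ≤ N₁) :
    ∃ C : ℝ, 0 ≤ C ∧ ∀ d : ℕ, 1 ≤ d → ∀ μ : Fin d → ℝ, (∀ i, |μ i| ≤ M) →
      |errProb σ N₁ N₂ μ -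
          phat ((∑ i, (μ i) ^ 2) / σ ^ 2) (N₁ : ℝ) ((N₂ : ℝ) / (N₁ : ℝ)) (d : ℝ)| ≤
        C / Real.sqrt d := by
  have h₁ : (0 : ℝ) < N₁ := by exact_mod_cast hN₁
  have h₂ : (0 : ℝ) < N₂ := by exact_mod_cast hN₂
  obtain ⟨C, hC, h⟩ := exists_abs_integral_lowTail_sub_le (a := σ ^ 2 / N₁) (b := σ ^ 2 / N₂)
    (c := 4 * σ ^ 2) (by positivity) (by positivity) (by positivity) (2 * M)
  refine ⟨C, hC, fun d hd μ hμ => ?_⟩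
  rw [errProb_eq hN₁ hN₂]
  have hT : 0 ≤ ∑ i, μ i ^ 2 := Finset.sum_nonneg fun i _ => sq_nonneg _
  rcases hT.eq_or_lt with hT | hT
  · have hμ0 : μ = 0 := by
      ext i
      have := (Finset.sum_eq_zero_iff_of_nonneg fun i _ => sq_nonneg (μ i)).1 hT.symm i
        (Finset.mem_univ i)
      simpa using this
    subst hμ0
    rw [← hT, zero_div, phat_zero]
    simp only [Pi.zero_apply, neg_zero]
    rw [← mul_add, add_sub_cancel, mul_one, sub_self, abs_zero]
    positivity
  have hM2 : ∀ i, |2 * μ i| ≤ 2 * M := fun i => by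
    rw [abs_mul, abs_two]; linarith [hμ i]
  have hM0 : ∀ i, |(0 : Fin d → ℝ) i| ≤ 2 * M := fun i => by simp; positivity
  have k1 := h d hd (fun i => 2 * μ i) 0 (fun i => 2 * μ i) hM2 hM0 hM2
  have k2 := h d hd 0 (fun i => -(2 * μ i)) (fun i => 2 * μ i) hM0
    (fun i => by rw [abs_neg]; exact hM2 i) hM2
  rw [phat_eq_lowTail hσ hT h₁ h₂ (Nat.cast_nonneg d)]
  have hsum : ∀ u v : ℝ, ∑ i, (u * μ i ^ 2 + v) = u * ∑ i, μ i ^ 2 + d * v := fun u v => by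
    simp [Finset.sum_add_distrib, Finset.mul_sum]
  have e1 : ∀ i, μ i - (-μ) i = 2 * μ i := fun i => by simp; ring
  have e2 : ∀ i, -μ i - (-μ) i = (0 : Fin d → ℝ) i := fun i => by simp
  have e3 : ∀ i, μ i - μ i = (0 : Fin d → ℝ) i := fun i => by simp
  have e4 : ∀ i, -μ i - μ i = -(2 * μ i) := fun i => by ring
  simp only [e1, e2, e3, e4]
  set a := σ ^ 2 / N₁
  set b := σ ^ 2 / N₂
  have z1 : ∑ i, ((2 * μ i) ^ 2 + b - (0 : Fin d → ℝ) i ^ 2 - a) =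
      4 * ∑ i, μ i ^ 2 + d * (b - a) := by
    rw [← hsum]; exact Finset.sum_congr rfl fun i _ => by simp; ring
  have z2 : ∑ i, ((0 : Fin d → ℝ) i ^ 2 + b - (-(2 * μ i)) ^ 2 - a) =
      -(4 * ∑ i, μ i ^ 2) + d * (b - a) := by
    rw [← neg_mul, ← hsum]; exact Finset.sum_congr rfl fun i _ => by simp; ring
  have v0 : ∑ i, 4 * σ ^ 2 * ((2 * μ i) ^ 2 + a + b) =
      4 * σ ^ 2 * (4 * ∑ i, μ i ^ 2 + d * (a + b)) := by
    rw [← hsum, ← Finset.mul_sum]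
    exact congrArg _ (Finset.sum_congr rfl fun i _ => by ring)
  have v1 : ∑ i, (4 * (2 * μ i) ^ 2 * b + 2 * b ^ 2 + (4 * (0 : Fin d → ℝ) i ^ 2 * a + 2 * a ^ 2)) =
      16 * b * ∑ i, μ i ^ 2 + d * (2 * a ^ 2 + 2 * b ^ 2) := by
    rw [← hsum]; exact Finset.sum_congr rfl fun i _ => by simp; ring
  have v2 : ∑ i, (4 * (0 : Fin d → ℝ) i ^ 2 * b + 2 * b ^ 2 +
      (4 * (-(2 * μ i)) ^ 2 * a + 2 * a ^ 2)) =
      16 * a * ∑ i, μ i ^ 2 + d * (2 * a ^ 2 + 2 * b ^ 2) := by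
    rw [← hsum]; exact Finset.sum_congr rfl fun i _ => by simp; ring
  rw [z1, v0, v1, ← add_assoc, mul_right_comm 16] at k1
  rw [z2, v0, v2, ← add_assoc, mul_right_comm 16] at k2
  rw [abs_le] at k1 k2 ⊢
  constructor <;> linarith [k1.1, k1.2, k2.1, k2.2]
end

section
/- Let 0 < γ < 1, 0 < S ≤ 1, let d and k be real numbers with d > k ≥ 1, and let N be a positive real number satisfying N ≥ (γ² − 4γ + 1)/(2γ(1 + γ)). Then p̂(S, N, γ, k) < p̂(S, N, γ, d). -/
open MeasureTheory

theorem hasDerivAt_gaussQ_s5 (x : ℝ) :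
    HasDerivAt gaussQ (-((Real.sqrt (2 * Real.pi))⁻¹ * Real.exp (-x ^ 2 / 2))) x := by
  have hint : Integrable (fun t : ℝ => Real.exp (-t ^ 2 / 2)) := by
    have h := integrable_exp_neg_mul_sq (b := 1 / 2) (by norm_num)
    refine h.congr (Filter.Eventually.of_forall fun t => ?_)
    simp only
    congr 1
    ring
  have hcont : Continuous (fun t : ℝ => Real.exp (-t ^ 2 / 2)) := by fun_prop
  have hQ : gaussQ = fun y => (Real.sqrt (2 * Real.pi))⁻¹ *
      ((∫ t in Set.Ioi 0, Real.exp (-t ^ 2 / 2)) - ∫ t in (0 : ℝ)..y, Real.exp (-t ^ 2 / 2)) := by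
    funext y
    have h := intervalIntegral.integral_interval_add_Ioi (a := 0) (b := y)
      hint.integrableOn hint.integrableOn
    rw [gaussQ, ← h]
    ring
  have hd := intervalIntegral.integral_hasDerivAt_right (hint.intervalIntegrable (a := 0) (b := x))
    hcont.stronglyMeasurable.stronglyMeasurableAtFilter hcont.continuousAt
  rw [hQ]
  exact ((hd.const_sub _).const_mul _).congr_deriv (by ring)

/-- Derivative of an affine function divided by the square root of an affine function. -/
theorem hasDerivAt_affine_div_sqrt_affine (s a b c u : ℝ) (hD : 0 < b * u + c) :
    HasDerivAt (fun v => s * (1 + a * v) / Real.sqrt (b * v + c))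
      (s * (a * b * u / 2 + a * c - b / 2) / ((b * u + c) * Real.sqrt (b * u + c))) u := by
  have hs : 0 < Real.sqrt (b * u + c) := Real.sqrt_pos.2 hD
  have hlin : HasDerivAt (fun v : ℝ => b * v + c) b u := by
    simpa using ((hasDerivAt_id u).const_mul b).add_const c
  have hnum : HasDerivAt (fun v : ℝ => s * (1 + a * v)) (s * a) u := by
    simpa using (((hasDerivAt_id u).const_mul a).const_add 1).const_mul s
  refine (hnum.div (hlin.sqrt hD.ne') hs.ne').congr_deriv ?_
  have hsq := Real.sq_sqrt hD.le
  set r := Real.sqrt (b * u + c)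
  rw [← hsq]
  field_simp
  rw [hsq]
  ring

/-- The Gaussian weights of the two error terms are strictly ordered. -/
theorem exp_div_lt_exp_div {S a b c u : ℝ} (hS0 : 0 < S) (hS1 : S ≤ 1) (ha : 0 < a)
    (hab : 4 * a ^ 2 ≤ b) (hc : 1 ≤ c) (hu : 0 < u) :
    Real.exp (-(Real.sqrt S * (1 + a * u) / Real.sqrt (b * u + (c + 4 * a))) ^ 2 / 2) /
        ((b * u + (c + 4 * a)) * Real.sqrt (b * u + (c + 4 * a))) <
      Real.exp (-(Real.sqrt S * (1 + -a * u) / Real.sqrt (b * u + c)) ^ 2 / 2) /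
        ((b * u + c) * Real.sqrt (b * u + c)) := by
  have hb : 0 < b := lt_of_lt_of_le (by positivity) hab
  have hbu : 0 < b * u := mul_pos hb hu
  obtain ⟨D, hD⟩ : ∃ D, D = b * u + c := ⟨_, rfl⟩
  have hD1 : 1 < D := by linarith
  have hD0 : 0 < D := by linarith
  have hE0 : 0 < D + 4 * a := by linarith
  rw [show b * u + (c + 4 * a) = D + 4 * a by linarith, ← hD]
  have hpow : ∀ x : ℝ, 0 < x → x * Real.sqrt x = Real.exp (3 / 2 * Real.log x) := fun x hx => by
    rw [show 3 / 2 * Real.log x = Real.log x + Real.log x / 2 by ring, Real.exp_add,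
      Real.exp_log hx, ← Real.log_sqrt hx.le, Real.exp_log (Real.sqrt_pos.2 hx)]
  rw [hpow _ hD0, hpow _ hE0, ← Real.exp_sub, ← Real.exp_sub, Real.exp_lt_exp]
  rw [div_pow, div_pow, mul_pow, mul_pow, Real.sq_sqrt hS0.le, Real.sq_sqrt hD0.le,
    Real.sq_sqrt hE0.le]
  have hlog : 4 * a / (D + 4 * a) ≤ Real.log (D + 4 * a) - Real.log D := by
    have h := Real.one_sub_inv_le_log_of_pos (div_pos hE0 hD0)
    rw [Real.log_div hE0.ne' hD0.ne'] at h
    refine le_trans (le_of_eq ?_) h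
    field_simp
    ring
  have hmain : S * (1 + -a * u) ^ 2 / D <
      S * (1 + a * u) ^ 2 / (D + 4 * a) + 3 * (4 * a / (D + 4 * a)) := by
    have hbound : S * (1 + -a * u) ^ 2 < D * (3 + u * S) := by
      have h1 : 0 ≤ S * u ^ 2 * (b - a ^ 2) := by
        apply mul_nonneg (by positivity)
        nlinarith [sq_nonneg a]
      have h2 : 0 < S * a * u := by positivity
      have h3 : b * u * (u * S) ≤ D * (u * S) := by
        apply mul_le_mul_of_nonneg_right (by linarith) (by positivity)
      nlinarith
    rw [← mul_div_assoc, ← add_div, div_lt_div_iff₀ hD0 hE0]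
    nlinarith [mul_lt_mul_of_pos_left hbound (show 0 < 4 * a by positivity)]
  rw [neg_div, neg_div]
  linarith

/-- Sum of the two error terms as a strictly increasing function of the rescaled dimension. -/
theorem strictMonoOn_gaussQ_add_gaussQ {S a b c : ℝ} (hS0 : 0 < S) (hS1 : S ≤ 1) (ha : 0 < a)
    (hab : 4 * a ^ 2 ≤ b) (hc : 1 ≤ c) :
    StrictMonoOn (fun u =>
      gaussQ (Real.sqrt S * (1 + a * u) / Real.sqrt (b * u + (c + 4 * a))) +
        gaussQ (Real.sqrt S * (1 + -a * u) / Real.sqrt (b * u + c))) (Set.Ioi 0) := by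
  have hb : 0 < b := lt_of_lt_of_le (by positivity) hab
  have hderiv : ∀ u ∈ Set.Ioi (0 : ℝ), HasDerivAt _ _ u := fun u hu =>
    ((hasDerivAt_gaussQ_s5 _).comp u (hasDerivAt_affine_div_sqrt_affine (Real.sqrt S) a b (c + 4 * a) u
      (by have := mul_pos hb hu; linarith))).add
    ((hasDerivAt_gaussQ_s5 _).comp u (hasDerivAt_affine_div_sqrt_affine (Real.sqrt S) (-a) b c u
      (by have := mul_pos hb hu; linarith)))
  refine strictMonoOn_of_deriv_pos (convex_Ioi 0)
    (fun u hu => (hderiv u hu).continuousAt.continuousWithinAt) fun u hu => ?_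
  rw [interior_Ioi] at hu
  refine lt_of_lt_of_eq ?_ (hderiv u hu).deriv.symm
  have hu0 : 0 < u := hu
  have hlt := exp_div_lt_exp_div hS0 hS1 ha hab hc hu0
  have hs : 0 < Real.sqrt S := Real.sqrt_pos.2 hS0
  have hbu : 0 < b * u := mul_pos hb hu0
  have hw : 0 < (Real.sqrt (2 * Real.pi))⁻¹ * Real.sqrt S := by positivity
  set w₁ := Real.exp (-(Real.sqrt S * (1 + a * u) / Real.sqrt (b * u + (c + 4 * a))) ^ 2 / 2)
  set w₂ := Real.exp (-(Real.sqrt S * (1 + -a * u) / Real.sqrt (b * u + c)) ^ 2 / 2)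
  set p₁ := (b * u + (c + 4 * a)) * Real.sqrt (b * u + (c + 4 * a))
  set p₂ := (b * u + c) * Real.sqrt (b * u + c)
  have hn : a * b * u / 2 + a * (c + 4 * a) - b / 2 ≤ a * b * u / 2 + a * c + b / 2 := by
    linarith
  have hn0 : 0 < a * b * u / 2 + a * c + b / 2 := by positivity
  have hw₁ : 0 ≤ w₁ / p₁ := by positivity
  have h := (mul_le_mul_of_nonneg_left hn hw₁).trans_lt (mul_lt_mul_of_pos_right hlt hn0)
  have h' := mul_pos hw (sub_pos.2 h)
  refine h'.trans_eq ?_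
  ring

theorem phat_eq {S N γ : ℝ} (hS : 0 < S) (hN : 0 < N) (hγ : 0 < γ) (q : ℝ) :
    phat S N γ q = 1 / 2 *
      (gaussQ (Real.sqrt S * (1 + (1 - γ) / (4 * N * γ) * (q / S)) /
          Real.sqrt (((1 + γ) / (4 * N * γ) + (1 + γ ^ 2) / (8 * N ^ 2 * γ ^ 2)) * (q / S) +
            (1 + 1 / N + 4 * ((1 - γ) / (4 * N * γ))))) +
        gaussQ (Real.sqrt S * (1 + -((1 - γ) / (4 * N * γ)) * (q / S)) /
          Real.sqrt (((1 + γ) / (4 * N * γ) + (1 + γ ^ 2) / (8 * N ^ 2 * γ ^ 2)) * (q / S) +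
            (1 + 1 / N)))) := by
  have hq : q / Real.sqrt S = Real.sqrt S * (q / S) := by
    have hs : 0 < Real.sqrt S := Real.sqrt_pos.2 hS
    have hsq := Real.sq_sqrt hS.le
    field_simp
    rw [hsq]
  rw [phat, hq, mul_add]
  congr 4
  · field_simp
  · congr 1
    field_simp
    ring
  · field_simp
    ring
  · congr 1
    field_simp
    ring

theorem gain_imbalanced (γ S d k N : ℝ) (hγ0 : 0 < γ) (hγ1 : γ < 1)
    (hS0 : 0 < S) (hS1 : S ≤ 1) (hk : 1 ≤ k) (hkd : k < d)
    (hN0 : 0 < N) (hN : (γ ^ 2 - 4 * γ + 1) / (2 * γ * (1 + γ)) ≤ N) :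
    phat S N γ k < phat S N γ d := by
  rw [phat_eq hS0 hN0 hγ0, phat_eq hS0 hN0 hγ0]
  have ha : 0 < (1 - γ) / (4 * N * γ) := div_pos (by linarith) (by positivity)
  have hab : 4 * ((1 - γ) / (4 * N * γ)) ^ 2 ≤
      (1 + γ) / (4 * N * γ) + (1 + γ ^ 2) / (8 * N ^ 2 * γ ^ 2) := by
    rw [div_le_iff₀ (by positivity)] at hN
    have h : 0 ≤ (2 * N * γ * (1 + γ) + (1 + γ ^ 2) - 2 * (1 - γ) ^ 2) / (8 * N ^ 2 * γ ^ 2) :=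
      div_nonneg (by linarith) (by positivity)
    rw [← sub_nonneg]
    refine h.trans_eq ?_
    field_simp
    ring
  have hc : 1 ≤ 1 + 1 / N := by
    have : 0 < 1 / N := by positivity
    linarith
  have hk0 : 0 < k := by linarith
  exact mul_lt_mul_of_pos_left
    (strictMonoOn_gaussQ_add_gaussQ hS0 hS1 ha hab hc (Set.mem_Ioi.2 (div_pos hk0 hS0))
      (Set.mem_Ioi.2 (div_pos (hk0.trans hkd) hS0)) (div_lt_div_of_pos_right hkd hS0))
    (by norm_num)
end

section
/- The function f : (0, ∞) → ℝ defined by f(S) = exp(−S/2) / (√S · Q(√S)) is strictly decreasing on (0, ∞). -/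
open MeasureTheory

lemma setIntegral_lt_setIntegral_of_forall_lt {α : Type*} [MeasurableSpace α] {μ : Measure α}
    {s : Set α} {f g : α → ℝ} (hs : MeasurableSet s) (hμ : μ s ≠ 0)
    (hf : IntegrableOn f s μ) (hg : IntegrableOn g s μ) (h : ∀ x ∈ s, f x < g x) :
    ∫ x in s, f x ∂μ < ∫ x in s, g x ∂μ := by
  rw [← sub_pos, ← integral_sub hg hf, setIntegral_pos_iff_support_of_nonneg_ae]
  · rw [Set.inter_eq_self_of_subset_right]
    · exact pos_iff_ne_zero.mpr hμ
    · intro x hx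
      exact (sub_pos.mpr (h x hx)).ne'
  · filter_upwards [ae_restrict_mem hs] with x hx
    exact (sub_pos.mpr (h x hx)).le
  · exact hg.sub hf

/-- The scaled Mills ratio `exp (S / 2) * √S * ∫_{√S}^∞ exp (-t² / 2) dt`, after the substitution
`t = √S + u / √S`. -/
noncomputable def millsIntegral (S : ℝ) : ℝ :=
  ∫ u in Set.Ioi (0 : ℝ), Real.exp (-u - u ^ 2 / (2 * S))

lemma integrableOn_exp_neg_sub_sq_div {S : ℝ} (hS : 0 ≤ S) :
    IntegrableOn (fun u : ℝ => Real.exp (-u - u ^ 2 / (2 * S))) (Set.Ioi 0) := by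
  refine (integrableOn_exp_neg_Ioi 0).mono' (by fun_prop) (ae_of_all _ fun u => ?_)
  rw [Real.norm_eq_abs, Real.abs_exp, Real.exp_le_exp]
  have : 0 ≤ u ^ 2 / (2 * S) := by positivity
  linarith

lemma millsIntegral_strictMonoOn : StrictMonoOn millsIntegral (Set.Ioi 0) := by
  intro a ha b hb hab
  rw [Set.mem_Ioi] at ha hb
  refine setIntegral_lt_setIntegral_of_forall_lt measurableSet_Ioi (by simp)
    (integrableOn_exp_neg_sub_sq_div ha.le) (integrableOn_exp_neg_sub_sq_div hb.le) fun u hu => ?_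
  rw [Set.mem_Ioi] at hu
  have : u ^ 2 / (2 * b) < u ^ 2 / (2 * a) := by gcongr
  exact Real.exp_lt_exp.mpr (by linarith)

lemma millsIntegral_pos {S : ℝ} (hS : 0 ≤ S) : 0 < millsIntegral S := by
  have h := setIntegral_lt_setIntegral_of_forall_lt (μ := volume) measurableSet_Ioi (by simp)
    integrableOn_zero (integrableOn_exp_neg_sub_sq_div hS) fun u _ => Real.exp_pos _
  simpa [millsIntegral] using h

lemma mul_integral_Ioi_exp_neg_sq_div_two {x : ℝ} (hx : 0 < x) :
    x * ∫ t in Set.Ioi x, Real.exp (-t ^ 2 / 2) =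
      Real.exp (-x ^ 2 / 2) * millsIntegral (x ^ 2) := by
  have hshift := (measurePreserving_add_right volume x).setIntegral_preimage_emb
    (measurableEmbedding_addRight x) (fun t : ℝ => Real.exp (-t ^ 2 / 2)) (Set.Ioi x)
  have hscale := integral_comp_mul_left_Ioi (fun t : ℝ => Real.exp (-(t + x) ^ 2 / 2)) 0
    (inv_pos.mpr hx)
  rw [Set.preimage_add_const_Ioi, sub_self] at hshift
  rw [mul_zero, inv_inv, smul_eq_mul, hshift] at hscale
  rw [← hscale, millsIntegral, ← integral_const_mul]
  congr 1 with u
  rw [← Real.exp_add]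
  congr 1
  field_simp
  ring

lemma exp_div_sqrt_mul_gaussQ {S : ℝ} (hS : 0 < S) :
    Real.exp (-S / 2) / (Real.sqrt S * gaussQ (Real.sqrt S)) =
      Real.sqrt (2 * Real.pi) / millsIntegral S := by
  have h := mul_integral_Ioi_exp_neg_sq_div_two (Real.sqrt_pos.mpr hS)
  rw [Real.sq_sqrt hS.le] at h
  have hM := (millsIntegral_pos hS.le).ne'
  have hpi : Real.sqrt (2 * Real.pi) ≠ 0 := (Real.sqrt_pos.mpr (by positivity)).ne'
  rw [gaussQ, mul_left_comm, h]
  have hexp := (Real.exp_pos (-S / 2)).ne'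
  field_simp

theorem efficiency_factor_strictAnti :
    StrictAntiOn (fun S : ℝ => Real.exp (-S / 2) / (Real.sqrt S * gaussQ (Real.sqrt S)))
      (Set.Ioi 0) := by
  intro a ha b hb hab
  have hmono := millsIntegral_strictMonoOn ha hb hab
  rw [Set.mem_Ioi] at ha hb
  have hpos := millsIntegral_pos ha.le
  have hpi : 0 < Real.sqrt (2 * Real.pi) := Real.sqrt_pos.mpr (by positivity)
  simp only [exp_div_sqrt_mul_gaussQ ha, exp_div_sqrt_mul_gaussQ hb]
  exact div_lt_div_of_pos_left hpi hpos hmono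
end
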